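/- Let x̄ be a solution of the parametric variational system v̄ ∈ f(x̄,p̄,q̄) + ∂_x g(x̄,p̄) and assume (A1)–(A4). Then the following two conditions hold simultaneously if and only if x̄ is a Lipschitzian fully stable solution corresponding to (v̄,p̄,q̄): (i) there exist η, κ₀ > 0 such that for every (u,p,v) ∈ gph ∂_x g with ‖u−x̄‖ ≤ η, d₁(p,p̄) ≤ η, ‖v−v̂‖ ≤ η one has ⟨∇_x f(x̄,p̄,q̄)w, w⟩ + ⟨z, w⟩ ≥ κ₀‖w‖² for all w ∈ X and all z ∈ D̂*(∂g_p)(u,v)(w); and (ii) the set-valued map K : p ↦ gph ∂_x g(·,p) ⊂ X × X is Lipschitz-like around (p̄,(x̄,v̂)). -/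

import Mathlib

noncomputable section

open Filter Topology Metric Set MeasureTheory
open scoped RealInnerProductSpace Pointwise

namespace PVS

variable {X : Type*} [NormedAddCommGroup X] [InnerProductSpace ℝ X]
variable {Y : Type*} [NormedAddCommGroup Y] [InnerProductSpace ℝ Y]
variable {W : Type*} [NormedAddCommGroup W] [InnerProductSpace ℝ W]
variable {P : Type*} [MetricSpace P]
variable {Q : Type*} [MetricSpace Q]

/-- Regular (Fréchet) subdifferential of an extended-real-valued function. -/
def regSubdiff (h : X → EReal) (x : X) : Set X :=
  {v | h x ≠ ⊤ ∧ h x ≠ ⊥ ∧ ∀ ε > (0:ℝ), ∀ᶠ u in 𝓝 x,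
      h x + ((⟪v, u - x⟫ - ε * ‖u - x‖ : ℝ) : EReal) ≤ h u}

/-- Weak sequential convergence in an inner product space. -/
def WeakTendsto (xs : ℕ → X) (x : X) : Prop :=
  ∀ z : X, Tendsto (fun k => ⟪xs k, z⟫) atTop (𝓝 ⟪x, z⟫)

/-- Limiting (Mordukhovich) subdifferential. -/
def limSubdiff (h : X → EReal) (x : X) : Set X :=
  {v | ∃ xs vs : ℕ → X, Tendsto xs atTop (𝓝 x) ∧
      Tendsto (fun k => h (xs k)) atTop (𝓝 (h x)) ∧
      (∀ k, vs k ∈ regSubdiff h (xs k)) ∧ WeakTendsto vs v}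

/-- Partial limiting subdifferential with respect to the first variable. -/
def pSubdiff {PP : Type*} (g : X → PP → EReal) (x : X) (p : PP) : Set X :=
  limSubdiff (fun x' => g x' p) x

/-- Graph of a set-valued map. -/
def gph (F : X → Set Y) : Set (X × Y) := {t | t.2 ∈ F t.1}

/-- Regular normal cone. -/
def regNC (Ω : Set X) (x : X) : Set X :=
  {v | ∀ ε > (0:ℝ), ∀ᶠ y in 𝓝[Ω] x, ⟪v, y - x⟫ ≤ ε * ‖y - x‖}

/-- Limiting normal cone. -/
def limNC (Ω : Set X) (x : X) : Set X :=
  {v | ∃ xs vs : ℕ → X, (∀ k, xs k ∈ Ω) ∧ Tendsto xs atTop (𝓝 x) ∧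
      (∀ k, vs k ∈ regNC Ω (xs k)) ∧ Tendsto vs atTop (𝓝 v)}

/-- Regular normal cone to a subset of a product of two inner product spaces,
with the Euclidean product norm. -/
def regNC2 (Ω : Set (X × Y)) (ω : X × Y) : Set (X × Y) :=
  {ζ | ∀ ε > (0:ℝ), ∀ᶠ y in 𝓝[Ω] ω,
      ⟪ζ.1, y.1 - ω.1⟫ + ⟪ζ.2, y.2 - ω.2⟫
        ≤ ε * Real.sqrt (‖y.1 - ω.1‖ ^ 2 + ‖y.2 - ω.2‖ ^ 2)}

/-- Limiting normal cone in a product of two spaces. -/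
def limNC2 (Ω : Set (X × Y)) (ω : X × Y) : Set (X × Y) :=
  {ζ | ∃ ωs ζs : ℕ → X × Y, (∀ k, ωs k ∈ Ω) ∧ Tendsto ωs atTop (𝓝 ω) ∧
      (∀ k, ζs k ∈ regNC2 Ω (ωs k)) ∧ Tendsto ζs atTop (𝓝 ζ)}

/-- Regular coderivative of a set-valued map. -/
def regCoderiv (F : X → Set Y) (u : X) (v : Y) (w : Y) : Set X :=
  {z | (z, -w) ∈ regNC2 (gph F) (u, v)}

/-- Limiting coderivative of a set-valued map. -/
def limCoderiv (F : X → Set Y) (u : X) (v : Y) (w : Y) : Set X :=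
  {z | (z, -w) ∈ limNC2 (gph F) (u, v)}

/-- Regular normal cone in a product of three inner product spaces. -/
def regNC3 (Ω : Set (X × W × Y)) (ω : X × W × Y) : Set (X × W × Y) :=
  {ζ | ∀ ε > (0:ℝ), ∀ᶠ y in 𝓝[Ω] ω,
      ⟪ζ.1, y.1 - ω.1⟫ + ⟪ζ.2.1, y.2.1 - ω.2.1⟫ + ⟪ζ.2.2, y.2.2 - ω.2.2⟫
        ≤ ε * Real.sqrt (‖y.1 - ω.1‖ ^ 2 + ‖y.2.1 - ω.2.1‖ ^ 2 + ‖y.2.2 - ω.2.2‖ ^ 2)}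

/-- Limiting normal cone in a product of three inner product spaces. -/
def limNC3 (Ω : Set (X × W × Y)) (ω : X × W × Y) : Set (X × W × Y) :=
  {ζ | ∃ ωs ζs : ℕ → X × W × Y, (∀ k, ωs k ∈ Ω) ∧ Tendsto ωs atTop (𝓝 ω) ∧
      (∀ k, ζs k ∈ regNC3 Ω (ωs k)) ∧ Tendsto ζs atTop (𝓝 ζ)}

/-- Limiting coderivative of the full partial subdifferential map (x,p) ↦ ∂ₓ g(x,p). -/
def limCoderivFull (g : X → W → EReal) (xb : X) (pb : W) (vh : X) (w : X) : Set (X × W) :=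
  {zs | (zs.1, zs.2, -w) ∈ limNC3 {t : X × W × X | t.2.2 ∈ pSubdiff g t.1 t.2.1} (xb, pb, vh)}

/-- Lipschitz-like (Aubin) property of a set-valued map around a graph point. -/
def LipschitzLike {α Z : Type*} [MetricSpace α] [SeminormedAddCommGroup Z]
    (F : α → Set Z) (ab : α) (zb : Z) : Prop :=
  ∃ ℓ > (0:ℝ), ∃ U ∈ 𝓝 ab, ∃ V ∈ 𝓝 zb,
    ∀ a ∈ U, ∀ a' ∈ U, ∀ z ∈ F a ∩ V, ∃ z' ∈ F a', ‖z - z'‖ ≤ ℓ * dist a a'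

/-- Epigraph of g(·,p). -/
def epi {PP : Type*} (g : X → PP → EReal) (p : PP) : Set (X × ℝ) :=
  {q | g q.1 p ≤ (q.2 : EReal)}

/-- (A1): Lipschitz continuity of the base around the reference point. -/
def A1 (f : X → P → Q → X) (xb : X) (pb : P) (qb : Q) : Prop :=
  ∃ L > (0:ℝ), ∃ ε > (0:ℝ), ∀ x₁ x₂ p₁ p₂ q₁ q₂,
    ‖x₁ - xb‖ < ε → ‖x₂ - xb‖ < ε → dist p₁ pb < ε → dist p₂ pb < ε →
    dist q₁ qb < ε → dist q₂ qb < ε →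
    ‖f x₁ p₁ q₁ - f x₂ p₂ q₂‖ ≤ L * (‖x₁ - x₂‖ + dist p₁ p₂ + dist q₁ q₂)

/-- Parametric prox-regularity with prox-parameter r. -/
def ProxRegWith (g : X → P → EReal) (xb : X) (pb : P) (vh : X) (r : ℝ) : Prop :=
  ∃ ε > (0:ℝ), ∀ x u p v, ‖x - xb‖ < ε → ‖u - xb‖ < ε → dist p pb < ε → ‖v - vh‖ < ε →
    v ∈ pSubdiff g u p →
    g u p + ((⟪v, x - u⟫ - r / 2 * ‖x - u‖ ^ 2 : ℝ) : EReal) ≤ g x p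

/-- Subdifferential continuity with compatible parameterization. -/
def SubdiffCont (g : X → P → EReal) (xb : X) (pb : P) (vh : X) : Prop :=
  Tendsto (fun t : X × P × X => g t.1 t.2.1)
    (𝓝[{t : X × P × X | t.2.2 ∈ pSubdiff g t.1 t.2.1}] (xb, pb, vh)) (𝓝 (g xb pb))

/-- (A2): parametric continuous prox-regularity. -/
def A2 (g : X → P → EReal) (xb : X) (pb : P) (vh : X) : Prop :=
  (∃ r > (0:ℝ), ProxRegWith g xb pb vh r) ∧ SubdiffCont g xb pb vh

/-- Threshold of prox-regularity. -/
def proxThreshold (g : X → P → EReal) (xb : X) (pb : P) (vh : X) : ℝ :=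
  sInf {r : ℝ | 0 < r ∧ ProxRegWith g xb pb vh r}

/-- (A3): basic constraint qualification. -/
def A3 (g : X → P → EReal) (xb : X) (pb : P) : Prop :=
  LipschitzLike (fun p => epi g p) pb (xb, (g xb pb).toReal)

/-- (A4): uniform partial differentiability with partial Jacobian continuous at the point. -/
def A4 (f : X → P → Q → X) (Df : X → P → Q → X →L[ℝ] X) (xb : X) (pb : P) (qb : Q) : Prop :=
  (∃ η > (0:ℝ), ∀ ε > (0:ℝ), ∃ δ > (0:ℝ), ∀ x p q,
      ‖x - xb‖ < η → dist p pb < η → dist q qb < η →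
      ∀ x', ‖x' - x‖ < δ →
        ‖f x' p q - f x p q - Df x p q (x' - x)‖ ≤ ε * ‖x' - x‖) ∧
  Tendsto (fun t : X × P × Q => Df t.1 t.2.1 t.2.2) (𝓝 (xb, pb, qb)) (𝓝 (Df xb pb qb))

/-- Solution map of the parametric variational system. -/
def SolMap (f : X → P → Q → X) (g : X → P → EReal) (v : X) (p : P) (q : Q) : Set X :=
  {x | v - f x p q ∈ pSubdiff g x p}

/-- Single-valued localization of a three-parametric solution map. -/
def Localizes3 (S : X → P → Q → Set X) (V : Set X) (Pn : Set P) (Qn : Set Q) (U : Set X)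
    (ϑ : X → P → Q → X) : Prop :=
  ∀ v ∈ V, ∀ p ∈ Pn, ∀ q ∈ Qn,
    ϑ v p q ∈ U ∧ ϑ v p q ∈ S v p q ∧ ∀ x ∈ U, x ∈ S v p q → x = ϑ v p q

/-- Lipschitzian full stability. -/
def LipFullStable (S : X → P → Q → Set X) (xb vb : X) (pb : P) (qb : Q) : Prop :=
  ∃ V ∈ 𝓝 vb, ∃ Pn ∈ 𝓝 pb, ∃ Qn ∈ 𝓝 qb, ∃ U ∈ 𝓝 xb, ∃ ϑ : X → P → Q → X,
    Localizes3 S V Pn Qn U ϑ ∧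
    ∃ κ > (0:ℝ), ∃ ℓ > (0:ℝ), ∀ v₁ ∈ V, ∀ p₁ ∈ Pn, ∀ q₁ ∈ Qn, ∀ v₂ ∈ V, ∀ p₂ ∈ Pn, ∀ q₂ ∈ Qn,
      ‖(v₁ - v₂) - (2 * κ) • (ϑ v₁ p₁ q₁ - ϑ v₂ p₂ q₂)‖
        ≤ ‖v₁ - v₂‖ + ℓ * (dist p₁ p₂ + dist q₁ q₂)

/-- Hölderian full stability with given moduli. -/
def HolderFullStableWith (S : X → P → Q → Set X) (xb vb : X) (pb : P) (qb : Q) (κ ℓ : ℝ) : Prop :=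
  ∃ V ∈ 𝓝 vb, ∃ Pn ∈ 𝓝 pb, ∃ Qn ∈ 𝓝 qb, ∃ U ∈ 𝓝 xb, ∃ ϑ : X → P → Q → X,
    Localizes3 S V Pn Qn U ϑ ∧
    ∀ v₁ ∈ V, ∀ p₁ ∈ Pn, ∀ q₁ ∈ Qn, ∀ v₂ ∈ V, ∀ p₂ ∈ Pn, ∀ q₂ ∈ Qn,
      ‖(v₁ - v₂) - (2 * κ) • (ϑ v₁ p₁ q₁ - ϑ v₂ p₂ q₂)‖
        ≤ ‖v₁ - v₂‖ + ℓ * (Real.sqrt (dist p₁ p₂) + dist q₁ q₂)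

/-- Hölderian full stability. -/
def HolderFullStable (S : X → P → Q → Set X) (xb vb : X) (pb : P) (qb : Q) : Prop :=
  ∃ κ > (0:ℝ), ∃ ℓ > (0:ℝ), HolderFullStableWith S xb vb pb qb κ ℓ

/-- Neighborhood second-order condition via the regular coderivative of ∂g_p. -/
def SOC (g : X → P → EReal) (A : X →L[ℝ] X) (xb : X) (pb : P) (vh : X) (η κ₀ : ℝ) : Prop :=
  ∀ u p v, ‖u - xb‖ ≤ η → dist p pb ≤ η → ‖v - vh‖ ≤ η → v ∈ pSubdiff g u p →
    ∀ w z, z ∈ regCoderiv (fun y => pSubdiff g y p) u v w →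
      κ₀ * ‖w‖ ^ 2 ≤ ⟪A w, w⟫ + ⟪z, w⟫

/-- The graphical map p ↦ gph ∂ₓ g(·,p). -/
def gphMap (g : X → P → EReal) (p : P) : Set (X × X) := {t | t.2 ∈ pSubdiff g t.1 p}

/-- Local strong monotonicity of f in x with modulus σ. -/
def StrongMono (f : X → P → Q → X) (xb : X) (pb : P) (qb : Q) (σ : ℝ) : Prop :=
  ∃ ε > (0:ℝ), ∀ x₁ x₂ p q, ‖x₁ - xb‖ < ε → ‖x₂ - xb‖ < ε → dist p pb < ε → dist q qb < ε →
    σ * ‖x₁ - x₂‖ ^ 2 ≤ ⟪f x₁ p q - f x₂ p q, x₁ - x₂⟫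

/-- The proximal mapping P_λ(v,p) = {x : v ∈ x + λ ∂ₓ g(x,p)}. -/
def proxMap (g : X → P → EReal) (lam : ℝ) (v : X) (p : P) : Set X :=
  {x | ∃ s ∈ pSubdiff g x p, v = x + lam • s}

/-- Single-valued localization of a two-parametric solution map. -/
def Localizes2 (S : X → P → Set X) (V : Set X) (Pn : Set P) (U : Set X) (ϑ : X → P → X) : Prop :=
  ∀ v ∈ V, ∀ p ∈ Pn, ϑ v p ∈ U ∧ ϑ v p ∈ S v p ∧ ∀ x ∈ U, x ∈ S v p → x = ϑ v p

/-- (Lipschitzian) full stability of a two-parametric system. -/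
def FullStable2 (S : X → P → Set X) (xb vb : X) (pb : P) : Prop :=
  ∃ V ∈ 𝓝 vb, ∃ Pn ∈ 𝓝 pb, ∃ U ∈ 𝓝 xb, ∃ ϑ : X → P → X,
    Localizes2 S V Pn U ϑ ∧
    ∃ κ > (0:ℝ), ∃ ℓ > (0:ℝ), ∀ v₁ ∈ V, ∀ p₁ ∈ Pn, ∀ v₂ ∈ V, ∀ p₂ ∈ Pn,
      ‖(v₁ - v₂) - (2 * κ) • (ϑ v₁ p₁ - ϑ v₂ p₂)‖ ≤ ‖v₁ - v₂‖ + ℓ * dist p₁ p₂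

/-- Normal cone of convex analysis. -/
def convNC (C : Set X) (x : X) : Set X := {v | x ∈ C ∧ ∀ y ∈ C, ⟪v, y - x⟫ ≤ 0}

/-- Solution map of a parametric variational inequality. -/
def SolMapVI (f : X → P → X) (C : Set X) (v : X) (p : P) : Set X :=
  {x | v - f x p ∈ convNC C x}

/-- Radial cone. -/
def radialCone (C : Set X) (x : X) : Set X := {w | ∃ t > (0:ℝ), x + t • w ∈ C}

/-- Tangent cone (closure of the radial cone). -/
def tangentC (C : Set X) (x : X) : Set X := closure (radialCone C x)

/-- Critical cone. -/
def criticalCone (C : Set X) (x v : X) : Set X := tangentC C x ∩ {w | ⟪v, w⟫ = 0}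

/-- Polyhedricity of a closed convex set. -/
def Polyhedric (C : Set X) : Prop :=
  ∀ x ∈ C, ∀ v ∈ convNC C x,
    criticalCone C x v = closure (radialCone C x ∩ {w | ⟪v, w⟫ = 0})

/-- Weak sequential outer limit of critical cones. -/
def Hw (C : Set X) (xb vh : X) : Set X :=
  {w | ∃ xs vs ws : ℕ → X, (∀ k, vs k ∈ convNC C (xs k)) ∧
      Tendsto xs atTop (𝓝 xb) ∧ Tendsto vs atTop (𝓝 vh) ∧
      (∀ k, ws k ∈ criticalCone C (xs k) (vs k)) ∧ WeakTendsto ws w}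

/-- Strong sequential outer limit of critical cones. -/
def Hs (C : Set X) (xb vh : X) : Set X :=
  {w | ∃ xs vs ws : ℕ → X, (∀ k, vs k ∈ convNC C (xs k)) ∧
      Tendsto xs atTop (𝓝 xb) ∧ Tendsto vs atTop (𝓝 vh) ∧
      (∀ k, ws k ∈ criticalCone C (xs k) (vs k)) ∧ Tendsto ws atTop (𝓝 w)}

/-- Convex polyhedron: finite intersection of closed half-spaces. -/
def IsPolyhedron (C : Set X) : Prop :=
  ∃ (k : ℕ) (a : Fin k → X) (b : Fin k → ℝ), C = {x | ∀ i, ⟪a i, x⟫ ≤ b i}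

/-- Legendre form. -/
def LegendreForm (Qf : X → ℝ) : Prop :=
  (∃ A : X →L[ℝ] X, ∀ x, Qf x = ⟪A x, x⟫) ∧
  (∀ (xs : ℕ → X) (x : X), WeakTendsto xs x → Qf x ≤ liminf (fun k => Qf (xs k)) atTop) ∧
  (∀ (xs : ℕ → X) (x : X), WeakTendsto xs x →
     Tendsto (fun k => Qf (xs k)) atTop (𝓝 (Qf x)) → Tendsto xs atTop (𝓝 x))

/-- (A1) for a two-parametric base mapping. -/
def A1two (f : X → P → X) (xb : X) (pb : P) : Prop :=
  ∃ L > (0:ℝ), ∃ ε > (0:ℝ), ∀ x₁ x₂ p₁ p₂,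
    ‖x₁ - xb‖ < ε → ‖x₂ - xb‖ < ε → dist p₁ pb < ε → dist p₂ pb < ε →
    ‖f x₁ p₁ - f x₂ p₂‖ ≤ L * (‖x₁ - x₂‖ + dist p₁ p₂)

/-- (A4) for a two-parametric base mapping. -/
def A4two (f : X → P → X) (Df : X → P → X →L[ℝ] X) (xb : X) (pb : P) : Prop :=
  (∃ η > (0:ℝ), ∀ ε > (0:ℝ), ∃ δ > (0:ℝ), ∀ x p,
      ‖x - xb‖ < η → dist p pb < η →
      ∀ x', ‖x' - x‖ < δ → ‖f x' p - f x p - Df x p (x' - x)‖ ≤ ε * ‖x' - x‖) ∧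
  Tendsto (fun t : X × P => Df t.1 t.2) (𝓝 (xb, pb)) (𝓝 (Df xb pb))

/-- Euclidean distance in X × ℝ. -/
def pairDist (a b : X × ℝ) : ℝ := Real.sqrt (‖a.1 - b.1‖ ^ 2 + |a.2 - b.2| ^ 2)

/-- Pompeiu–Hausdorff distance between subsets of X × ℝ (Euclidean product norm). -/
def hausPH (C₁ C₂ : Set (X × ℝ)) : ℝ :=
  sInf {η : ℝ | 0 ≤ η ∧ (∀ a ∈ C₁, ∃ b ∈ C₂, pairDist a b ≤ η) ∧
                 ∀ b ∈ C₂, ∃ a ∈ C₁, pairDist a b ≤ η}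

/-- Nonparametric prox-regularity with parameter r. -/
def ProxRegWithNP (g : X → EReal) (xb vh : X) (r : ℝ) : Prop :=
  ∃ ε > (0:ℝ), ∀ x u v, ‖x - xb‖ < ε → ‖u - xb‖ < ε → ‖v - vh‖ < ε →
    v ∈ limSubdiff g u → g u ≤ g xb + (ε : EReal) →
    g u + ((⟪v, x - u⟫ - r / 2 * ‖x - u‖ ^ 2 : ℝ) : EReal) ≤ g x

/-- Nonparametric subdifferential continuity. -/
def SubdiffContNP (g : X → EReal) (xb vh : X) : Prop :=
  Tendsto (fun t : X × X => g t.1) (𝓝[gph (limSubdiff g)] (xb, vh)) (𝓝 (g xb))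

/-- Nonparametric threshold of prox-regularity. -/
def proxThresholdNP (g : X → EReal) (xb vh : X) : ℝ :=
  sInf {r : ℝ | 0 < r ∧ ProxRegWithNP g xb vh r}

/-- Smooth variational principle: a function with closed epigraph over a bounded set `D` of a
Hilbert space, bounded below on `D`, attains its minimum over `D` after a small quadratic
perturbation. -/
theorem exists_quadratic_perturbation_min [CompleteSpace X] {D : Set X} {h : X → ℝ} {x₀ : X}
    {R m δ : ℝ} (hx₀ : x₀ ∈ D) (hD : D ⊆ closedBall x₀ R)
    (hcl : IsClosed {t : X × ℝ | t.1 ∈ D ∧ h t.1 ≤ t.2}) (hm : ∀ x ∈ D, m ≤ h x) (hδ : 0 < δ) :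
    ∃ x ∈ D, ∃ z, ‖z - x₀‖ ≤ R ∧
      ∀ u ∈ D, h x + δ * ‖x - z‖ ^ 2 ≤ h u + δ * ‖u - z‖ ^ 2 := by
  set w : ℕ → ℝ := fun n => (1 / 2) ^ n / 2 with hw
  have hwpos : ∀ n, 0 < w n := fun n => by positivity
  have hwsum : HasSum w 1 := by
    have := (hasSum_geometric_two).div_const 2
    simpa [hw] using this
  set e : ℕ → ℝ := fun n => δ * (1 / 8) ^ n with he
  have hepos : ∀ n, 0 < e n := fun n => by positivity
  -- approximate minimizers
  have happrox : ∀ (n : ℕ) (φ : X → ℝ), ∃ x, (∀ y ∈ D, m ≤ φ y) →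
      x ∈ D ∧ ∀ u ∈ D, φ x ≤ φ u + e n := by
    intro n φ
    by_cases hφ : ∀ y ∈ D, m ≤ φ y
    · have hne : (φ '' D).Nonempty := ⟨φ x₀, x₀, hx₀, rfl⟩
      have hbdd : BddBelow (φ '' D) := ⟨m, by rintro _ ⟨y, hy, rfl⟩; exact hφ y hy⟩
      obtain ⟨_, ⟨x, hx, rfl⟩, hlt⟩ := exists_lt_of_csInf_lt hne
        (show sInf (φ '' D) < sInf (φ '' D) + e n by linarith [hepos n])
      refine ⟨x, fun _ => ⟨hx, fun u hu => ?_⟩⟩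
      have := csInf_le hbdd ⟨u, hu, rfl⟩
      linarith
    · exact ⟨x₀, fun h => absurd h hφ⟩
  choose pick hpick using happrox
  let φ : ℕ → X → ℝ := fun n => Nat.rec h
    (fun n ψ => fun u => ψ u + δ * w n * ‖u - pick n ψ‖ ^ 2) n
  set x : ℕ → X := fun n => pick n (φ n) with hx
  have hφs : ∀ n u, φ (n + 1) u = φ n u + δ * w n * ‖u - x n‖ ^ 2 := fun n u => rfl
  have hφ : ∀ n u, φ n u = h u + δ * ∑ i ∈ Finset.range n, w i * ‖u - x i‖ ^ 2 := by
    intro n u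
    induction n with
    | zero => simp [φ]
    | succ k ih => rw [hφs, ih, Finset.sum_range_succ]; ring
  have hφm : ∀ n, ∀ y ∈ D, m ≤ φ n y := by
    intro n y hy
    rw [hφ]
    have : 0 ≤ δ * ∑ i ∈ Finset.range n, w i * ‖y - x i‖ ^ 2 :=
      mul_nonneg hδ.le (Finset.sum_nonneg fun i _ => mul_nonneg (hwpos i).le (sq_nonneg _))
    linarith [hm y hy]
  have hxD : ∀ n, x n ∈ D := fun n => (hpick n _ (hφm n)).1
  have hxmin : ∀ n, ∀ u ∈ D, φ n (x n) ≤ φ n u + e n := fun n => (hpick n _ (hφm n)).2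
  have hstep : ∀ n, dist (x n) (x (n + 1)) ≤ 2 * (1 / 2) ^ n := by
    intro n
    have h1 := hxmin (n + 1) (x n) (hxD n)
    have h2 := hxmin n (x (n + 1)) (hxD (n + 1))
    rw [hφs, hφs] at h1
    simp only [sub_self, norm_zero] at h1
    have h3 : δ * w n * ‖x (n + 1) - x n‖ ^ 2 ≤ e n + e (n + 1) := by linarith
    rw [dist_comm, dist_eq_norm]
    apply le_of_sq_le_sq _ (by positivity)
    have h4 : e n + e (n + 1) ≤ δ * w n * (2 * (1 / 2) ^ n) ^ 2 := by
      have : (1 / 8 : ℝ) ^ n = (1 / 2) ^ n * (1 / 2) ^ n * (1 / 2) ^ n := by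
        rw [← mul_pow, ← mul_pow]; norm_num
      simp only [he, hw, pow_succ, this]
      have : 0 ≤ δ * ((1 / 2 : ℝ) ^ n * (1 / 2) ^ n * (1 / 2) ^ n) := by positivity
      nlinarith
    exact le_of_mul_le_mul_left (h3.trans h4) (mul_pos hδ (hwpos n))
  obtain ⟨xs, hxs⟩ := cauchySeq_tendsto_of_complete
    (cauchySeq_of_le_geometric (1 / 2) 2 (by norm_num) hstep)
  -- the barycentre of the approximate minimizers
  have hR : ∀ n, ‖x n - x₀‖ ≤ R := fun n => by simpa [dist_eq_norm] using hD (hxD n)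
  have hnorm : ∀ n, ‖w n • (x n - x₀)‖ ≤ w n * R := fun n => by
    rw [norm_smul, Real.norm_of_nonneg (hwpos n).le]
    exact mul_le_mul_of_nonneg_left (hR n) (hwpos n).le
  have hwR : HasSum (fun n => w n * R) R := by simpa using hwsum.mul_right R
  have hs : Summable fun n => w n • (x n - x₀) := Summable.of_norm_bounded hwR.summable hnorm
  set b := ∑' n, w n • (x n - x₀) with hb
  have hbn : ‖b‖ ≤ R := tsum_of_norm_bounded hwR hnorm
  have hs2 : Summable fun n => w n * ‖x n - x₀‖ ^ 2 := by
    refine Summable.of_nonneg_of_le (fun n => mul_nonneg (hwpos n).le (sq_nonneg _)) (fun n => ?_)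
      (hwsum.summable.mul_right (R ^ 2))
    exact mul_le_mul_of_nonneg_left (pow_le_pow_left₀ (norm_nonneg _) (hR n) 2) (hwpos n).le
  set c := ∑' n, w n * ‖x n - x₀‖ ^ 2 with hc
  have hsum : ∀ u, HasSum (fun n => w n * ‖u - x n‖ ^ 2) (‖u - (x₀ + b)‖ ^ 2 + (c - ‖b‖ ^ 2)) := by
    intro u
    have h1 := ((hwsum.mul_right (‖u - x₀‖ ^ 2)).sub
      ((hs.hasSum.mapL (innerSL ℝ (u - x₀))).mul_left 2)).add hs2.hasSum
    have hf : ∀ n, w n * ‖u - x n‖ ^ 2 = w n * ‖u - x₀‖ ^ 2 -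
        2 * innerSL ℝ (u - x₀) (w n • (x n - x₀)) + w n * ‖x n - x₀‖ ^ 2 := fun n => by
      have : u - x n = (u - x₀) - (x n - x₀) := by abel
      rw [this, norm_sub_sq_real]
      simp only [innerSL_apply_apply, inner_smul_right]
      ring
    have hv : ‖u - (x₀ + b)‖ ^ 2 + (c - ‖b‖ ^ 2) =
        1 * ‖u - x₀‖ ^ 2 - 2 * innerSL ℝ (u - x₀) b + c := by
      have : u - (x₀ + b) = (u - x₀) - b := by abel
      rw [this, norm_sub_sq_real]
      simp only [innerSL_apply_apply]
      ring
    simp only [hf, hv]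
    exact h1
  have hpart : ∀ u n, ∑ i ∈ Finset.range n, w i * ‖u - x i‖ ^ 2 ≤
      ‖u - (x₀ + b)‖ ^ 2 + (c - ‖b‖ ^ 2) := fun u n =>
    sum_le_hasSum _ (fun i _ => mul_nonneg (hwpos i).le (sq_nonneg _)) (hsum u)
  have helim : Tendsto e atTop (𝓝 0) := by
    simpa [he] using (tendsto_pow_atTop_nhds_zero_of_lt_one
      (show (0:ℝ) ≤ 1 / 8 by norm_num) (by norm_num)).const_mul δ
  have hlim : ∀ u ∈ D, ∀ k, xs ∈ D ∧ h xs ≤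
      h u + δ * (‖u - (x₀ + b)‖ ^ 2 + (c - ‖b‖ ^ 2)) + 0 -
        δ * ∑ i ∈ Finset.range k, w i * ‖xs - x i‖ ^ 2 := by
    intro u hu k
    have hT : Tendsto (fun n => (x n, h u + δ * (‖u - (x₀ + b)‖ ^ 2 + (c - ‖b‖ ^ 2)) + e n -
        δ * ∑ i ∈ Finset.range k, w i * ‖x n - x i‖ ^ 2)) atTop
        (𝓝 (xs, h u + δ * (‖u - (x₀ + b)‖ ^ 2 + (c - ‖b‖ ^ 2)) + 0 -
        δ * ∑ i ∈ Finset.range k, w i * ‖xs - x i‖ ^ 2)) := by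
      refine hxs.prodMk_nhds ((tendsto_const_nhds.add helim).sub
        (Tendsto.const_mul _ (tendsto_finsetSum _ fun i _ => ?_)))
      exact ((hxs.sub_const _).norm.pow 2).const_mul _
    refine hcl.mem_of_tendsto hT ?_
    filter_upwards [eventually_ge_atTop k] with n hn
    refine ⟨hxD n, ?_⟩
    have h1 := hxmin n u hu
    rw [hφ, hφ] at h1
    have h2 : ∑ i ∈ Finset.range k, w i * ‖x n - x i‖ ^ 2 ≤
        ∑ i ∈ Finset.range n, w i * ‖x n - x i‖ ^ 2 :=
      Finset.sum_le_sum_of_subset_of_nonneg (Finset.range_mono hn)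
        (fun i _ _ => mul_nonneg (hwpos i).le (sq_nonneg _))
    have h3 := mul_le_mul_of_nonneg_left h2 hδ.le
    have h4 := mul_le_mul_of_nonneg_left (hpart u n) hδ.le
    show h (x n) ≤ _
    linarith
  refine ⟨xs, (hlim x₀ hx₀ 0).1, x₀ + b, by simpa using hbn, fun u hu => ?_⟩
  have hT := ((hsum xs).tendsto_sum_nat.const_mul δ).const_sub
    (h u + δ * (‖u - (x₀ + b)‖ ^ 2 + (c - ‖b‖ ^ 2)) + 0)
  have := ge_of_tendsto' hT fun k => (hlim u hu k).2
  linarith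

set_option maxHeartbeats 1000000 in
/-- Approximate mean value inequality: the increment of a Lipschitz function on a ball of a
Hilbert space is controlled by regular subgradients at points of the ball. -/
theorem exists_regular_subgradient_mean_value [CompleteSpace X] {φ : X → ℝ} {c₀ y₁ y₂ : X}
    {ρ K ε : ℝ} (hφ : ∀ y ∈ ball c₀ ρ, ∀ y' ∈ ball c₀ ρ, |φ y - φ y'| ≤ K * ‖y - y'‖)
    (hK : 0 ≤ K) (h₁ : y₁ ∈ ball c₀ ρ) (h₂ : y₂ ∈ ball c₀ ρ) (hε : 0 < ε) :
    ∃ c ∈ ball c₀ ρ, ∃ ω : X,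
      (∀ ε' > (0:ℝ), ∀ᶠ y in 𝓝 c, φ c + ⟪ω, y - c⟫ - ε' * ‖y - c‖ ≤ φ y) ∧
      φ y₁ - φ y₂ - ε ≤ ⟪ω, y₁ - y₂⟫ := by
  obtain ⟨ε, rfl⟩ : ∃ ε₀, ε = 2 * ε₀ := ⟨ε / 2, by ring⟩
  replace hε : 0 < ε := by linarith
  obtain ⟨ρ₁, hρ₁, hρ₁ρ⟩ := exists_between
    (max_lt (mem_ball_iff_norm.1 h₁) (mem_ball_iff_norm.1 h₂))
  obtain ⟨ρ₂, hρ₁₂, hρ₂ρ⟩ := exists_between hρ₁ρ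
  have hρ₁0 : 0 < ρ₁ := (norm_nonneg _).trans_lt ((le_max_left _ _).trans_lt hρ₁)
  have hn₁ : ‖y₁ - c₀‖ < ρ₁ := (le_max_left _ _).trans_lt hρ₁
  have hn₂ : ‖y₂ - c₀‖ < ρ₁ := (le_max_right _ _).trans_lt hρ₁
  set d := y₁ - y₂ with hd
  set Δ := φ y₁ - φ y₂ with hΔ
  set τ := ρ₂ - ρ₁ with hτ
  have hτ0 : 0 < τ := by linarith
  have hsub : closedBall c₀ ρ₂ ⊆ ball c₀ ρ := closedBall_subset_ball hρ₂ρ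
  have hseg : ∀ t ∈ Icc (0:ℝ) 1, ‖y₂ + t • d - c₀‖ < ρ₁ := by
    intro t ht
    have := (convex_ball c₀ ρ₁) (mem_ball_iff_norm.2 hn₂) (mem_ball_iff_norm.2 hn₁)
      (show 0 ≤ 1 - t by linarith [ht.2]) ht.1 (by ring)
    rw [mem_ball_iff_norm] at this
    have h : y₂ + t • d = (1 - t) • y₂ + t • y₁ := by
      rw [hd, smul_sub, sub_smul, one_smul]; abel
    rwa [h]
  have hsegB : ∀ t ∈ Icc (0:ℝ) 1, y₂ + t • d ∈ ball c₀ ρ := fun t ht =>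
    mem_ball_iff_norm.2 ((hseg t ht).trans (by linarith))
  -- constants
  set δ := min (ε / (64 * ρ₂ ^ 2 + 1)) (ε / (8 * ρ₂ * ‖d‖ + 1)) with hδ
  have hρ₂0 : 0 < ρ₂ := by linarith
  have hδ0 : 0 < δ := lt_min (by positivity) (by positivity)
  have hδ1 : δ * (4 * ρ₂ ^ 2) ≤ ε / 4 := by
    have h := mul_le_mul_of_nonneg_right (min_le_left (ε / (64 * ρ₂ ^ 2 + 1))
      (ε / (8 * ρ₂ * ‖d‖ + 1))) (show 0 ≤ 64 * ρ₂ ^ 2 + 1 by positivity)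
    rw [div_mul_cancel₀ _ (by positivity)] at h
    nlinarith
  have hδ2 : 8 * δ * ρ₂ * ‖d‖ ≤ ε := by
    have h := mul_le_mul_of_nonneg_right (min_le_right (ε / (64 * ρ₂ ^ 2 + 1))
      (ε / (8 * ρ₂ * ‖d‖ + 1))) (show 0 ≤ 8 * ρ₂ * ‖d‖ + 1 by positivity)
    rw [div_mul_cancel₀ _ (by positivity)] at h
    nlinarith
  set C := K * ‖d‖ + |Δ| + ε with hC
  have hC0 : 0 < C := by positivity
  set N := K ^ 2 / ε + (K / τ + C / τ ^ 2) + 1 with hN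
  have hN0 : 0 < N := by positivity
  have hN1 : ∀ e : ℝ, -(ε / 4) ≤ N * e ^ 2 - K * e := by
    intro e
    have : K ^ 2 / ε * e ^ 2 ≤ N * e ^ 2 := by
      apply mul_le_mul_of_nonneg_right _ (sq_nonneg e)
      have : 0 ≤ K / τ + C / τ ^ 2 := by positivity
      rw [hN]; linarith
    have h2 : K ^ 2 / ε * e ^ 2 - K * e + ε / 4 = (K * e / ε - 1 / 2) ^ 2 * ε := by
      field_simp; ring
    have h3 : 0 ≤ (K * e / ε - 1 / 2) ^ 2 * ε := by positivity
    linarith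
  have hN2 : ∀ e : ℝ, τ ≤ e → C < N * e ^ 2 - K * e := by
    intro e he
    have h1 : (K / τ + C / τ ^ 2) * e ^ 2 < N * e ^ 2 := by
      apply mul_lt_mul_of_pos_right _ (pow_pos (hτ0.trans_le he) 2)
      have : 0 ≤ K ^ 2 / ε := by positivity
      rw [hN]; linarith
    have h2 : K * e ≤ K / τ * e ^ 2 := by
      rw [div_mul_eq_mul_div, le_div_iff₀ hτ0]
      have : 0 ≤ K * e := mul_nonneg hK (hτ0.le.trans he)
      nlinarith
    have h3 : C ≤ C / τ ^ 2 * e ^ 2 := by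
      rw [div_mul_eq_mul_div, le_div_iff₀ (by positivity)]
      exact mul_le_mul_of_nonneg_left (pow_le_pow_left₀ hτ0.le he 2) hC0.le
    linarith
  -- the marginal penalty function
  set q : X → ℝ → ℝ := fun y t => N * ‖y - (y₂ + t • d)‖ ^ 2 - (Δ - ε) * t with hq
  have hqc : Continuous ↿q := by
    change Continuous fun p : X × ℝ => N * ‖p.1 - (y₂ + p.2 • d)‖ ^ 2 - (Δ - ε) * p.2
    fun_prop
  set θ : X → ℝ := fun y => sInf (q y '' Icc (0:ℝ) 1) with hθ
  have hθc : Continuous θ := isCompact_Icc.continuous_sInf hqc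
  have hθle : ∀ y, ∀ t ∈ Icc (0:ℝ) 1, θ y ≤ q y t := fun y t ht =>
    csInf_le (isCompact_Icc.image (hqc.comp (by fun_prop : Continuous fun t : ℝ => (y, t)))).bddBelow
      ⟨t, ht, rfl⟩
  have hθex : ∀ y, ∃ t ∈ Icc (0:ℝ) 1, θ y = q y t := fun y => by
    obtain ⟨t, ht, h⟩ := isCompact_Icc.exists_sInf_image_eq (nonempty_Icc.2 zero_le_one)
      (hqc.comp (by fun_prop : Continuous fun t : ℝ => (y, t))).continuousOn
    exact ⟨t, ht, h⟩
  have hφc : ContinuousOn φ (closedBall c₀ ρ₂) := by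
    have : LipschitzOnWith (Real.toNNReal K) φ (closedBall c₀ ρ₂) :=
      LipschitzOnWith.of_dist_le_mul fun x hx y hy => by
        rw [Real.dist_eq, dist_eq_norm, Real.coe_toNNReal _ hK]
        exact hφ x (hsub hx) y (hsub hy)
    exact this.continuousOn
  have hy₂m : y₂ ∈ closedBall c₀ ρ₂ := mem_closedBall_iff_norm.2 (by linarith)
  have hlow : ∀ y ∈ closedBall c₀ ρ₂, ∀ t ∈ Icc (0:ℝ) 1,
      φ (y₂ + t • d) - K * ‖y - (y₂ + t • d)‖ ≤ φ y := by
    intro y hy t ht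
    have := (abs_le.1 (hφ y (hsub hy) _ (hsegB t ht))).1
    linarith
  have hseglow : ∀ t ∈ Icc (0:ℝ) 1, φ y₂ - K * ‖d‖ ≤ φ (y₂ + t • d) := by
    intro t ht
    have h1 := (abs_le.1 (hφ _ (hsegB t ht) y₂ h₂)).1
    have h2 : ‖y₂ + t • d - y₂‖ ≤ ‖d‖ := by
      rw [add_sub_cancel_left, norm_smul, Real.norm_of_nonneg ht.1]
      exact mul_le_of_le_one_left (norm_nonneg _) ht.2
    have := mul_le_mul_of_nonneg_left h2 hK
    linarith
  have htΔ : ∀ t ∈ Icc (0:ℝ) 1, (Δ - ε) * t ≤ |Δ| := by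
    intro t ht
    have h1 : (Δ - ε) * t ≤ Δ * t := mul_le_mul_of_nonneg_right (by linarith) ht.1
    have h2 : Δ * t ≤ |Δ| * t := mul_le_mul_of_nonneg_right (le_abs_self _) ht.1
    have h3 : |Δ| * t ≤ |Δ| := mul_le_of_le_one_right (abs_nonneg _) ht.2
    linarith
  have hcl : IsClosed {t : X × ℝ | t.1 ∈ closedBall c₀ ρ₂ ∧ φ t.1 + θ t.1 ≤ t.2} :=
    (lowerSemicontinuousOn_iff_isClosed_epigraph isClosed_closedBall).1
      (hφc.add hθc.continuousOn).lowerSemicontinuousOn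
  obtain ⟨c, hc, z, hz, hmin⟩ := exists_quadratic_perturbation_min
    (h := fun y => φ y + θ y) (R := 2 * ρ₂)
    (m := φ y₂ - K * ‖d‖ - ε / 4 - |Δ|) hy₂m
    (fun y hy => by
      rw [mem_closedBall_iff_norm] at *
      have : y - y₂ = (y - c₀) - (y₂ - c₀) := by abel
      rw [this]
      exact (norm_sub_le _ _).trans (by linarith)) hcl
    (fun y hy => by
      obtain ⟨t, ht, h⟩ := hθex y
      have h1 := hlow y hy t ht
      have h2 := hN1 ‖y - (y₂ + t • d)‖
      have h3 := hseglow t ht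
      have h4 := htΔ t ht
      have h5 : q y t = N * ‖y - (y₂ + t • d)‖ ^ 2 - (Δ - ε) * t := rfl
      rw [h, h5]
      linarith) hδ0
  obtain ⟨t, ht, hct⟩ := hθex c
  set e := ‖c - (y₂ + t • d)‖ with he
  have hmin₂ : φ c + q c t ≤ φ y₂ + ε / 4 := by
    have h1 := hmin y₂ hy₂m
    have h2 := hθle y₂ 0 ⟨le_rfl, zero_le_one⟩
    simp only [hq, zero_smul, add_zero, sub_self, norm_zero, mul_zero] at h2
    have h3 : δ * ‖y₂ - z‖ ^ 2 ≤ δ * (4 * ρ₂ ^ 2) := by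
      apply mul_le_mul_of_nonneg_left _ hδ0.le
      rw [norm_sub_rev]
      calc ‖z - y₂‖ ^ 2 ≤ (2 * ρ₂) ^ 2 := pow_le_pow_left₀ (norm_nonneg _) hz 2
        _ = _ := by ring
    have h4 : 0 ≤ δ * ‖c - z‖ ^ 2 := by positivity
    rw [hct] at h1
    norm_num at h2
    linarith
  have hqe : q c t = N * e ^ 2 - (Δ - ε) * t := rfl
  have heτ : e < τ := by
    by_contra! hcon
    have h1 := hN2 e hcon
    have h2 := hlow c hc t ht
    have h3 := hseglow t ht
    have h4 := htΔ t ht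
    rw [hqe] at hmin₂
    linarith
  have ht1 : t < 1 := by
    refine lt_of_le_of_ne ht.2 fun h1 => ?_
    have h2 := hlow c hc t ht
    have h3 := hN1 e
    have h4 : y₂ + t • d = y₁ := by rw [h1, one_smul, hd]; abel
    rw [hqe, h1] at hmin₂
    rw [← he, h4] at h2
    linarith
  have hcin : c ∈ ball c₀ ρ₂ := by
    rw [mem_ball_iff_norm]
    have h1 : c - c₀ = (c - (y₂ + t • d)) + (y₂ + t • d - c₀) := by abel
    rw [h1]
    exact (norm_add_le _ _).trans_lt (by linarith [hseg t ht])
  set b := c - (y₂ + t • d) with hb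
  refine ⟨c, hsub hc, -(2 * N) • b - (2 * δ) • (c - z), fun ε' hε' => ?_, ?_⟩
  · have hev : ∀ᶠ y in 𝓝 c, y ∈ ball c (ε' / (N + δ)) :=
      ball_mem_nhds c (by positivity)
    filter_upwards [isOpen_ball.mem_nhds hcin, hev] with y hy hy'
    have h1 := hmin y (ball_subset_closedBall hy)
    have h2 := hθle y t ht
    rw [hct, hqe] at h1
    simp only [hq] at h2
    have h3 : y - (y₂ + t • d) = b + (y - c) := by rw [hb]; abel
    have h4 : y - z = (c - z) + (y - c) := by abel
    rw [h3, norm_add_sq_real] at h2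
    rw [h4, norm_add_sq_real (c - z)] at h1
    rw [mem_ball_iff_norm, lt_div_iff₀ (by positivity)] at hy'
    have h5 : (N + δ) * ‖y - c‖ ^ 2 ≤ ε' * ‖y - c‖ := by
      nlinarith [norm_nonneg (y - c)]
    rw [inner_sub_left, real_inner_smul_left, real_inner_smul_left]
    linarith
  · have hqmin : ∀ t' ∈ Icc (0:ℝ) 1, q c t ≤ q c t' := fun t' ht' => hct ▸ hθle c t' ht'
    have hder : ∀ σ : ℝ, 0 < σ → σ ≤ 1 - t →
        (Δ - ε) ≤ -(2 * N) * ⟪b, d⟫ + N * ‖d‖ ^ 2 * σ := by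
      intro σ hσ hσ1
      have h1 := hqmin (t + σ) ⟨by linarith [ht.1], by linarith⟩
      have h4 : q c (t + σ) = N * ‖c - (y₂ + (t + σ) • d)‖ ^ 2 - (Δ - ε) * (t + σ) := rfl
      have h2 : c - (y₂ + (t + σ) • d) = b - σ • d := by rw [hb, add_smul]; abel
      rw [hqe, h4, h2, norm_sub_sq_real b, inner_smul_right, norm_smul, mul_pow,
        Real.norm_eq_abs, sq_abs] at h1
      have h3 : σ * (Δ - ε) ≤ σ * (-(2 * N) * ⟪b, d⟫ + N * ‖d‖ ^ 2 * σ) := by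
        rw [← he] at h1
        linarith
      exact le_of_mul_le_mul_left h3 hσ
    have hlim : (Δ - ε) ≤ -(2 * N) * ⟪b, d⟫ + N * ‖d‖ ^ 2 * 0 := by
      have hT : Tendsto (fun σ : ℝ => -(2 * N) * ⟪b, d⟫ + N * ‖d‖ ^ 2 * σ) (𝓝[>] 0)
          (𝓝 (-(2 * N) * ⟪b, d⟫ + N * ‖d‖ ^ 2 * 0)) :=
        ((continuous_const.add (continuous_const.mul continuous_id)).tendsto 0).mono_left
          nhdsWithin_le_nhds
      refine ge_of_tendsto hT ?_
      filter_upwards [Ioc_mem_nhdsGT (show (0:ℝ) < 1 - t by linarith)] with σ hσ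
      exact hder σ hσ.1 hσ.2
    have hcz : ‖c - z‖ ≤ 4 * ρ₂ := by
      have h1 : c - z = (c - c₀) - (y₂ - c₀) - (z - y₂) := by abel
      rw [mem_ball_iff_norm] at hcin
      rw [h1]
      linarith [norm_sub_le (c - c₀ - (y₂ - c₀)) (z - y₂), norm_sub_le (c - c₀) (y₂ - c₀)]
    have hpert : 2 * δ * ⟪c - z, d⟫ ≤ ε := by
      have h1 : ⟪c - z, d⟫ ≤ 4 * ρ₂ * ‖d‖ :=
        (real_inner_le_norm _ _).trans (mul_le_mul_of_nonneg_right hcz (norm_nonneg _))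
      have := mul_le_mul_of_nonneg_left h1 (show 0 ≤ 2 * δ by positivity)
      linarith
    simp only [inner_sub_left, real_inner_smul_left] at hpert ⊢
    linarith

/-- The proximal inequality of prox-regularity, in terms of real numbers. -/
theorem limSubdiff_proximal {h : X → EReal} (hbot : ∀ x, h x ≠ ⊥) {xb vh : X} {ε r : ℝ}
    (hprox : ∀ x u v, ‖x - xb‖ < ε → ‖u - xb‖ < ε → ‖v - vh‖ < ε → v ∈ limSubdiff h u →
      h u + ((⟪v, x - u⟫ - r / 2 * ‖x - u‖ ^ 2 : ℝ) : EReal) ≤ h x)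
    {u v : X} (hu : ‖u - xb‖ < ε) (hv : ‖v - vh‖ < ε) (hmem : v ∈ limSubdiff h u) :
    h u ≠ ⊤ ∧ ∀ x, ‖x - xb‖ < ε → h x ≠ ⊤ →
      (h u).toReal + ⟪v, x - u⟫ - r / 2 * ‖x - u‖ ^ 2 ≤ (h x).toReal := by
  have hfin : h u ≠ ⊤ := by
    obtain ⟨xs, vs, hxs, -, hvs, -⟩ := id hmem
    have hev : ∀ᶠ k in atTop, ‖xs k - xb‖ < ε :=
      ((hxs.sub_const xb).norm).eventually_lt_const hu
    obtain ⟨k, hk⟩ := hev.exists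
    intro htop
    have h1 := hprox (xs k) u v hk hu hv hmem
    rw [htop, EReal.top_add_coe, top_le_iff] at h1
    exact (hvs k).1 h1
  refine ⟨hfin, fun x hx hxt => ?_⟩
  have h1 := hprox x u v hx hu hv hmem
  rw [← EReal.coe_toReal hfin (hbot u), ← EReal.coe_toReal hxt (hbot x), ← EReal.coe_add,
    EReal.coe_le_coe_iff] at h1
  linarith

/-- A proximal subgradient is a limiting subgradient. -/
theorem mem_limSubdiff_of_proximal {h : X → EReal} (hbot : ∀ x, h x ≠ ⊥) {u v : X} {c : ℝ}
    (hu : h u ≠ ⊤) (hev : ∀ᶠ x in 𝓝 u, h x ≠ ⊤ →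
      (h u).toReal + ⟪v, x - u⟫ - c * ‖x - u‖ ^ 2 ≤ (h x).toReal) : v ∈ limSubdiff h u := by
  refine ⟨fun _ => u, fun _ => v, tendsto_const_nhds, tendsto_const_nhds,
    fun _ => ⟨hu, hbot u, fun ε hε => ?_⟩, fun _ => tendsto_const_nhds⟩
  have hev' : ∀ᶠ x in 𝓝 u, x ∈ ball u (ε / (|c| + 1)) := ball_mem_nhds u (by positivity)
  filter_upwards [hev, hev'] with x hx hx'
  by_cases hxt : h x = ⊤
  · rw [hxt]; exact le_top
  have h1 := hx hxt
  rw [mem_ball_iff_norm, lt_div_iff₀ (by positivity)] at hx'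
  rw [← EReal.coe_toReal hu (hbot u), ← EReal.coe_toReal hxt (hbot x), ← EReal.coe_add,
    EReal.coe_le_coe_iff]
  have h2 : c * ‖x - u‖ ^ 2 ≤ ε * ‖x - u‖ := by
    have h3 : c * ‖x - u‖ ^ 2 ≤ |c| * ‖x - u‖ ^ 2 :=
      mul_le_mul_of_nonneg_right (le_abs_self c) (sq_nonneg _)
    nlinarith [norm_nonneg (x - u)]
  linarith

/-- Under prox-regularity the subdifferential is locally hypomonotone. -/
theorem limSubdiff_hypomonotone {h : X → EReal} (hbot : ∀ x, h x ≠ ⊥) {xb vh : X} {ε r : ℝ}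
    (hprox : ∀ x u v, ‖x - xb‖ < ε → ‖u - xb‖ < ε → ‖v - vh‖ < ε → v ∈ limSubdiff h u →
      h u + ((⟪v, x - u⟫ - r / 2 * ‖x - u‖ ^ 2 : ℝ) : EReal) ≤ h x)
    {u₁ v₁ u₂ v₂ : X} (hu₁ : ‖u₁ - xb‖ < ε) (hv₁ : ‖v₁ - vh‖ < ε) (h₁ : v₁ ∈ limSubdiff h u₁)
    (hu₂ : ‖u₂ - xb‖ < ε) (hv₂ : ‖v₂ - vh‖ < ε) (h₂ : v₂ ∈ limSubdiff h u₂) :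
    -(r * ‖u₁ - u₂‖ ^ 2) ≤ ⟪v₁ - v₂, u₁ - u₂⟫ := by
  obtain ⟨ht₁, hp₁⟩ := limSubdiff_proximal hbot hprox hu₁ hv₁ h₁
  obtain ⟨ht₂, hp₂⟩ := limSubdiff_proximal hbot hprox hu₂ hv₂ h₂
  have h3 := hp₁ u₂ hu₂ ht₂
  have h4 := hp₂ u₁ hu₁ ht₁
  rw [norm_sub_rev] at h3
  have h5 : ⟪v₁ - v₂, u₁ - u₂⟫ = -⟪v₁, u₂ - u₁⟫ - ⟪v₂, u₁ - u₂⟫ := by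
    rw [inner_sub_left, ← neg_sub u₂ u₁, inner_neg_right]
  linarith

/-- The resolvent of the shifted subdifferential is firmly Lipschitz on graph points in the
window of prox-regularity. -/
theorem limSubdiff_resolvent_lipschitz {h : X → EReal} (hbot : ∀ x, h x ≠ ⊥) {xb vh : X}
    {ε r s : ℝ}
    (hprox : ∀ x u v, ‖x - xb‖ < ε → ‖u - xb‖ < ε → ‖v - vh‖ < ε → v ∈ limSubdiff h u →
      h u + ((⟪v, x - u⟫ - r / 2 * ‖x - u‖ ^ 2 : ℝ) : EReal) ≤ h x)
    {u₁ v₁ u₂ v₂ : X} (hu₁ : ‖u₁ - xb‖ < ε) (hv₁ : ‖v₁ - vh‖ < ε) (h₁ : v₁ ∈ limSubdiff h u₁)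
    (hu₂ : ‖u₂ - xb‖ < ε) (hv₂ : ‖v₂ - vh‖ < ε) (h₂ : v₂ ∈ limSubdiff h u₂) :
    (s - r) * ‖u₁ - u₂‖ ≤ ‖(v₁ + s • u₁) - (v₂ + s • u₂)‖ := by
  have h3 := limSubdiff_hypomonotone hbot hprox hu₁ hv₁ h₁ hu₂ hv₂ h₂
  have h4 : ⟪(v₁ + s • u₁) - (v₂ + s • u₂), u₁ - u₂⟫ =
      ⟪v₁ - v₂, u₁ - u₂⟫ + s * ‖u₁ - u₂‖ ^ 2 := by
    rw [← real_inner_self_eq_norm_sq, ← real_inner_smul_left, ← inner_add_left, smul_sub]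
    congr 1; abel
  have h5 := real_inner_le_norm ((v₁ + s • u₁) - (v₂ + s • u₂)) (u₁ - u₂)
  rcases (norm_nonneg (u₁ - u₂)).eq_or_lt with h6 | h6
  · rw [← h6, mul_zero]; exact norm_nonneg _
  · refine le_of_mul_le_mul_right ?_ h6
    nlinarith

/-- Local surjectivity of the shifted subdifferential of a prox-regular function. -/
theorem exists_resolvent [CompleteSpace X] {h : X → EReal} (hlsc : LowerSemicontinuous h)
    (hbot : ∀ x, h x ≠ ⊥) {xb vh : X} {ε r s R : ℝ} (hr : 0 < r) (hrs : r < s) (hR : 0 < R)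
    (hprox : ∀ x u v, ‖x - xb‖ < ε → ‖u - xb‖ < ε → ‖v - vh‖ < ε → v ∈ limSubdiff h u →
      h u + ((⟪v, x - u⟫ - r / 2 * ‖x - u‖ ^ 2 : ℝ) : EReal) ≤ h x)
    {x₀ v₀ : X} (h₀ : v₀ ∈ limSubdiff h x₀) (hx₀ : ‖x₀ - xb‖ + R < ε)
    (hv₀ : ‖v₀ - vh‖ + 2 * s * R < ε) {y : X}
    (hy : ‖y - (v₀ + s • x₀)‖ ≤ (s - r) * R / 8) :
    ∃ x, ‖x - x₀‖ ≤ R ∧ y - s • x ∈ limSubdiff h x := by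
  have hs0 : 0 < s := hr.trans hrs
  have hσ : 0 < s - r := sub_pos.2 hrs
  obtain ⟨ht₀, hp₀⟩ := limSubdiff_proximal hbot hprox (by linarith) (by nlinarith) h₀
  set ψ : X → ℝ := fun x => (h x).toReal + (s / 2 * ‖x‖ ^ 2 - ⟪y, x⟫) with hψ
  set D : Set X := {x | x ∈ closedBall x₀ R ∧ h x ≠ ⊤} with hD
  have hwin : ∀ x ∈ closedBall x₀ R, ‖x - xb‖ < ε := by
    intro x hx
    rw [mem_closedBall_iff_norm] at hx
    have := norm_sub_le_norm_sub_add_norm_sub x x₀ xb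
    linarith
  have hcl : IsClosed {t : X × ℝ | t.1 ∈ D ∧ ψ t.1 ≤ t.2} := by
    have h1 : {t : X × ℝ | t.1 ∈ D ∧ ψ t.1 ≤ t.2} = {t : X × ℝ | t.1 ∈ closedBall x₀ R} ∩
        (fun t : X × ℝ => (t.1, ((t.2 - (s / 2 * ‖t.1‖ ^ 2 - ⟪y, t.1⟫) : ℝ) : EReal))) ⁻¹'
          {p : X × EReal | h p.1 ≤ p.2} := by
      ext ⟨x, c⟩
      simp only [hD, hψ, mem_ofPred_eq, mem_inter_iff, mem_preimage, and_assoc]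
      refine and_congr_right fun _ => ⟨fun ⟨hx, hc⟩ => ?_, fun hc => ?_⟩
      · rw [← EReal.coe_toReal hx (hbot x), EReal.coe_le_coe_iff]
        linarith
      · have hx : h x ≠ ⊤ := ne_top_of_le_ne_top (EReal.coe_ne_top _) hc
        rw [← EReal.coe_toReal hx (hbot x), EReal.coe_le_coe_iff] at hc
        exact ⟨hx, by linarith⟩
    rw [h1]
    refine (isClosed_closedBall.preimage continuous_fst).inter
      (hlsc.isClosed_epigraph.preimage ?_)
    exact continuous_fst.prodMk (continuous_coe_real_ereal.comp (by fun_prop))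
  -- growth of the shifted function
  set η := ‖y - (v₀ + s • x₀)‖ with hη
  have hgrow : ∀ x ∈ D, ψ x₀ + (s - r) / 2 * ‖x - x₀‖ ^ 2 - η * ‖x - x₀‖ ≤ ψ x := by
    rintro x ⟨hx, hxt⟩
    have h1 := hp₀ x (hwin x hx) hxt
    have h2 := real_inner_le_norm (y - (v₀ + s • x₀)) (x - x₀)
    rw [inner_sub_left, inner_add_left, real_inner_smul_left] at h2
    have h3 : ‖x‖ ^ 2 = ‖x₀‖ ^ 2 + 2 * ⟪x₀, x - x₀⟫ + ‖x - x₀‖ ^ 2 := by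
      rw [← norm_add_sq_real, add_sub_cancel]
    have h4 : ⟪y, x - x₀⟫ = ⟪y, x⟫ - ⟪y, x₀⟫ := inner_sub_right _ _ _
    simp only [hψ]
    rw [h3]
    linarith
  have hx₀D : x₀ ∈ D := ⟨mem_closedBall_self hR.le, ht₀⟩
  have happrox : ∀ δ, 0 < δ → δ < (s - r) / 16 → ∃ x, ‖x - x₀‖ ≤ R ∧ ∃ v,
      v ∈ limSubdiff h x ∧ ‖v - vh‖ < ε ∧ ‖(v + s • x) - y‖ ≤ 4 * R * δ := by
    intro δ hδ hδσ
    obtain ⟨x, hxD, z, hz, hmin⟩ := exists_quadratic_perturbation_min (D := D) (h := ψ) (R := R)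
      (m := ψ x₀ - η * R) hx₀D (fun x hx => hx.1) hcl
      (fun x hx => by
        have h1 := hgrow x hx
        have h2 : η * ‖x - x₀‖ ≤ η * R :=
          mul_le_mul_of_nonneg_left (mem_closedBall_iff_norm.1 hx.1) (norm_nonneg _)
        have h3 : 0 ≤ (s - r) / 2 * ‖x - x₀‖ ^ 2 := by positivity
        linarith) hδ
    have hxR : ‖x - x₀‖ ≤ R := mem_closedBall_iff_norm.1 hxD.1
    have hxlt : ‖x - x₀‖ < R := by
      refine lt_of_le_of_ne hxR fun heq => ?_
      have h1 := hmin x₀ hx₀D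
      have h2 := hgrow x hxD
      have h3 : δ * ‖x₀ - z‖ ^ 2 ≤ δ * R ^ 2 := by
        rw [norm_sub_rev]
        exact mul_le_mul_of_nonneg_left (pow_le_pow_left₀ (norm_nonneg _) hz 2) hδ.le
      have h4 : 0 ≤ δ * ‖x - z‖ ^ 2 := by positivity
      rw [heq] at h2
      have h5 : η * R ≤ (s - r) * R / 8 * R := mul_le_mul_of_nonneg_right hy hR.le
      have h6 : δ * R ^ 2 < (s - r) / 16 * R ^ 2 := mul_lt_mul_of_pos_right hδσ (by positivity)
      nlinarith [show 0 < (s - r) * R ^ 2 by positivity]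
    have hxz : ‖x - z‖ ≤ 2 * R := by
      have h1 : x - z = (x - x₀) - (z - x₀) := by abel
      rw [h1]
      exact (norm_sub_le _ _).trans (by linarith)
    have hpert : ‖(2 * δ) • (x - z)‖ ≤ 4 * R * δ := by
      rw [norm_smul, Real.norm_of_nonneg (by positivity)]
      nlinarith
    refine ⟨x, hxR, y - s • x - (2 * δ) • (x - z), ?_, ?_, ?_⟩
    · refine mem_limSubdiff_of_proximal (c := s / 2 + δ) hbot hxD.2 ?_
      filter_upwards [isOpen_ball.mem_nhds (mem_ball_iff_norm.2 hxlt)] with u hu hut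
      have h1 := hmin u ⟨ball_subset_closedBall hu, hut⟩
      have h2 : ‖u‖ ^ 2 = ‖x‖ ^ 2 + 2 * ⟪x, u - x⟫ + ‖u - x‖ ^ 2 := by
        rw [← norm_add_sq_real, add_sub_cancel]
      have h3 : ‖u - z‖ ^ 2 = ‖x - z‖ ^ 2 + 2 * ⟪x - z, u - x⟫ + ‖u - x‖ ^ 2 := by
        rw [← norm_add_sq_real]; congr 2; abel
      have h4 : ⟪y, u - x⟫ = ⟪y, u⟫ - ⟪y, x⟫ := inner_sub_right _ _ _
      simp only [hψ] at h1
      rw [h2, h3] at h1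
      rw [inner_sub_left, inner_sub_left, real_inner_smul_left, real_inner_smul_left]
      linarith
    · have h1 : y - s • x - (2 * δ) • (x - z) - vh = (v₀ - vh) + (y - (v₀ + s • x₀)) -
          s • (x - x₀) - (2 * δ) • (x - z) := by
        rw [smul_sub s]; abel
      have h2 : ‖s • (x - x₀)‖ ≤ s * R := by
        rw [norm_smul, Real.norm_of_nonneg hs0.le]
        exact mul_le_mul_of_nonneg_left hxR hs0.le
      rw [h1]
      have h3 := norm_sub_le ((v₀ - vh) + (y - (v₀ + s • x₀)) - s • (x - x₀)) ((2 * δ) • (x - z))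
      have h4 := norm_sub_le ((v₀ - vh) + (y - (v₀ + s • x₀))) (s • (x - x₀))
      have h5 := norm_add_le (v₀ - vh) (y - (v₀ + s • x₀))
      have h6 : 4 * R * δ ≤ 4 * R * ((s - r) / 16) :=
        mul_le_mul_of_nonneg_left hδσ.le (by positivity)
      nlinarith [mul_pos hr hR, mul_pos hσ hR]
    · have h1 : y - s • x - (2 * δ) • (x - z) + s • x - y = -((2 * δ) • (x - z)) := by abel
      rw [h1, norm_neg]
      exact hpert
  -- passage to the limit
  set δ : ℕ → ℝ := fun n => (s - r) / 32 * (1 / 2) ^ n with hδ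
  have hδ0 : ∀ n, 0 < δ n := fun n => by positivity
  have hδσ : ∀ n, δ n < (s - r) / 16 := fun n => by
    have : (1 / 2 : ℝ) ^ n ≤ 1 := pow_le_one₀ (by norm_num) (by norm_num)
    simp only [hδ]
    nlinarith
  have hδlim : Tendsto δ atTop (𝓝 0) := by
    simpa [hδ] using (tendsto_pow_atTop_nhds_zero_of_lt_one
      (show (0:ℝ) ≤ 1 / 2 by norm_num) (by norm_num)).const_mul ((s - r) / 32)
  choose x hxR v hv hvw hvy using fun n => happrox (δ n) (hδ0 n) (hδσ n)
  have hxw : ∀ n, ‖x n - xb‖ < ε := fun n => hwin _ (mem_closedBall_iff_norm.2 (hxR n))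
  have hylim : Tendsto (fun n => v n + s • x n) atTop (𝓝 y) := by
    rw [tendsto_iff_norm_sub_tendsto_zero]
    refine squeeze_zero (fun _ => norm_nonneg _) hvy ?_
    simpa using hδlim.const_mul (4 * R)
  have hcau : CauchySeq x := by
    rw [Metric.cauchySeq_iff]
    intro e he
    obtain ⟨n, hn⟩ := Metric.cauchySeq_iff.1 hylim.cauchySeq ((s - r) * e) (by positivity)
    refine ⟨n, fun i hi j hj => ?_⟩
    have h1 := limSubdiff_resolvent_lipschitz (s := s) hbot hprox (hxw i) (hvw i) (hv i)
      (hxw j) (hvw j) (hv j)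
    have h2 := hn i hi j hj
    rw [dist_eq_norm] at h2 ⊢
    exact lt_of_mul_lt_mul_left (h1.trans_lt h2) hσ.le
  obtain ⟨xs, hxs⟩ := cauchySeq_tendsto_of_complete hcau
  have hvlim : Tendsto v atTop (𝓝 (y - s • xs)) := by
    simpa using hylim.sub (hxs.const_smul s)
  have hxsR : ‖xs - x₀‖ ≤ R := le_of_tendsto' ((hxs.sub_const x₀).norm) hxR
  refine ⟨xs, hxsR, ?_⟩
  have hkey : ∀ u, ‖u - xb‖ < ε → h u ≠ ⊤ →
      h xs ≤ (((h u).toReal - (⟪y - s • xs, u - xs⟫ - r / 2 * ‖u - xs‖ ^ 2) : ℝ) : EReal) := by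
    intro u hu hut
    have hT : Tendsto (fun n => (x n, (((h u).toReal -
        (⟪v n, u - x n⟫ - r / 2 * ‖u - x n‖ ^ 2) : ℝ) : EReal))) atTop
        (𝓝 (xs, (((h u).toReal - (⟪y - s • xs, u - xs⟫ - r / 2 * ‖u - xs‖ ^ 2) : ℝ) : EReal))) := by
      refine hxs.prodMk_nhds ((continuous_coe_real_ereal.tendsto _).comp ?_)
      have h1 := hxs.const_sub u
      exact ((hvlim.inner h1).sub ((h1.norm.pow 2).const_mul _)).const_sub _
    refine hlsc.isClosed_epigraph.mem_of_tendsto hT (Eventually.of_forall fun n => ?_)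
    obtain ⟨h1, h2⟩ := limSubdiff_proximal hbot hprox (hxw n) (hvw n) (hv n)
    show h (x n) ≤ _
    rw [← EReal.coe_toReal h1 (hbot _), EReal.coe_le_coe_iff]
    linarith [h2 u hu hut]
  have hxst : h xs ≠ ⊤ :=
    ne_top_of_le_ne_top (EReal.coe_ne_top _) (hkey x₀ (by linarith) ht₀)
  refine mem_limSubdiff_of_proximal (c := r / 2) hbot hxst ?_
  have hxsw : xs ∈ ball xb ε := mem_ball_iff_norm.2 (hwin xs (mem_closedBall_iff_norm.2 hxsR))
  filter_upwards [isOpen_ball.mem_nhds hxsw] with u hu hut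
  have h1 := hkey u (mem_ball_iff_norm.1 hu) hut
  rw [← EReal.coe_toReal hxst (hbot _), EReal.coe_le_coe_iff] at h1
  linarith

/-- Single-valued selection of the shifted subdifferential on a ball. -/
theorem exists_local_resolvent [CompleteSpace X] {h : X → EReal} (hlsc : LowerSemicontinuous h)
    (hbot : ∀ x, h x ≠ ⊥) {xb vh : X} {ε r s R : ℝ} (hr : 0 < r) (hrs : r < s) (hR : 0 < R)
    (hprox : ∀ x u v, ‖x - xb‖ < ε → ‖u - xb‖ < ε → ‖v - vh‖ < ε → v ∈ limSubdiff h u →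
      h u + ((⟪v, x - u⟫ - r / 2 * ‖x - u‖ ^ 2 : ℝ) : EReal) ≤ h x)
    {x₀ v₀ yc : X} (h₀ : v₀ ∈ limSubdiff h x₀) (hx₀ : ‖x₀ - xb‖ + R < ε)
    (hv₀ : ‖v₀ - vh‖ + 2 * s * R < ε) (hyc : ‖(v₀ + s • x₀) - yc‖ ≤ (s - r) * R / 16) :
    ∃ J : X → X, ∀ y ∈ ball yc ((s - r) * R / 16), y - s • J y ∈ limSubdiff h (J y) ∧
      ‖J y - x₀‖ ≤ R ∧ ‖y - s • J y - v₀‖ ≤ 2 * s * R := by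
  have hs0 : 0 < s := hr.trans hrs
  have key : ∀ y, ∃ x, y ∈ ball yc ((s - r) * R / 16) → y - s • x ∈ limSubdiff h x ∧
      ‖x - x₀‖ ≤ R ∧ ‖y - s • x - v₀‖ ≤ 2 * s * R := by
    intro y
    by_cases hy : y ∈ ball yc ((s - r) * R / 16)
    · have h1 : ‖y - (v₀ + s • x₀)‖ ≤ (s - r) * R / 8 := by
        have h2 := norm_sub_le_norm_sub_add_norm_sub y yc (v₀ + s • x₀)
        rw [norm_sub_rev yc] at h2
        rw [mem_ball_iff_norm] at hy
        linarith
      obtain ⟨x, hx, hxm⟩ := exists_resolvent hlsc hbot hr hrs hR hprox h₀ hx₀ hv₀ h1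
      refine ⟨x, fun _ => ⟨hxm, hx, ?_⟩⟩
      have h3 : y - s • x - v₀ = (y - (v₀ + s • x₀)) - s • (x - x₀) := by
        rw [smul_sub]; abel
      have h4 : ‖s • (x - x₀)‖ ≤ s * R := by
        rw [norm_smul, Real.norm_of_nonneg hs0.le]
        exact mul_le_mul_of_nonneg_left hx hs0.le
      rw [h3]
      refine (norm_sub_le _ _).trans ?_
      nlinarith [mul_pos hr hR, mul_pos hs0 hR]
    · exact ⟨0, fun h => absurd h hy⟩
  choose J hJ using key
  exact ⟨J, hJ⟩

/-- A lower estimate for the coderivative along a Lipschitz selection of the shifted inverse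
yields a strong monotonicity estimate for the selection. -/
theorem strong_inequality_of_coderivative [CompleteSpace X] {T : X → Set X} {J : X → X}
    {A : X →L[ℝ] X} {yc : X} {s σ ρ κ : ℝ} (hs : 0 < s) (hσ : 0 < σ) (hA : ‖A‖ ≤ s + κ)
    (hlip : ∀ y ∈ ball yc ρ, ∀ y' ∈ ball yc ρ, σ * ‖J y - J y'‖ ≤ ‖y - y'‖)
    (huniq : ∀ y ∈ ball yc ρ, ∀ᶠ t : X × X in 𝓝 (J y, y - s • J y), t.2 ∈ T t.1 →
      J (t.2 + s • t.1) = t.1)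
    (hsoc : ∀ y ∈ ball yc ρ, ∀ w z, z ∈ regCoderiv T (J y) (y - s • J y) w →
      κ * ‖w‖ ^ 2 ≤ ⟪A w, w⟫ + ⟪z, w⟫)
    {y₁ y₂ : X} (h₁ : y₁ ∈ ball yc ρ) (h₂ : y₂ ∈ ball yc ρ) :
    (s + κ) * ‖J y₁ - J y₂‖ ^ 2 - ⟪A (J y₁ - J y₂), J y₁ - J y₂⟫ ≤ ⟪y₁ - y₂, J y₁ - J y₂⟫ := by
  set d := J y₁ - J y₂ with hd
  set a := (2 * (s + κ)) • d - A d - ContinuousLinearMap.adjoint A d - (y₁ - y₂) with ha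
  have hinner : ∀ ω, ⟪a, ω⟫ = 2 * (s + κ) * ⟪d, ω⟫ - ⟪A d, ω⟫ - ⟪A ω, d⟫ - ⟪y₁ - y₂, ω⟫ := by
    intro ω
    rw [ha, inner_sub_left, inner_sub_left, inner_sub_left, real_inner_smul_left,
      ContinuousLinearMap.adjoint_inner_left, real_inner_comm (A ω) d]
  refine le_of_forall_pos_le_add fun e he => ?_
  obtain ⟨c, hc, ω, hω, hmv⟩ := exists_regular_subgradient_mean_value (φ := fun y => ⟪a, J y⟫)
    (K := ‖a‖ / σ) (ρ := ρ) (c₀ := yc) (y₁ := y₁) (y₂ := y₂)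
    (fun y hy y' hy' => by
      rw [← inner_sub_right]
      refine (abs_real_inner_le_norm _ _).trans ?_
      have h1 := hlip y hy y' hy'
      rw [div_mul_eq_mul_div, le_div_iff₀ hσ]
      nlinarith [norm_nonneg a]) (by positivity) h₁ h₂ he
  have hcod : s • ω - a ∈ regCoderiv T (J c) (c - s • J c) (-ω) := by
    intro e' he'
    rw [neg_neg]
    have hcont : Tendsto (fun t : X × X => t.2 + s • t.1) (𝓝 (J c, c - s • J c)) (𝓝 c) := by
      have h1 : Continuous fun t : X × X => t.2 + s • t.1 := by fun_prop
      simpa using h1.tendsto (J c, c - s • J c)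
    have hev := hcont.eventually (hω (e' / (1 + s)) (by positivity))
    rw [eventually_nhdsWithin_iff]
    filter_upwards [hev, huniq c hc] with t ht htu htT
    have h2 := htu htT
    rw [h2] at ht
    have h3 : t.2 + s • t.1 - c = (t.2 - (c - s • J c)) + s • (t.1 - J c) := by
      rw [smul_sub]; abel
    have h4 : ‖t.2 + s • t.1 - c‖ ≤
        (1 + s) * Real.sqrt (‖t.1 - J c‖ ^ 2 + ‖t.2 - (c - s • J c)‖ ^ 2) := by
      rw [h3]
      refine (norm_add_le _ _).trans ?_
      rw [norm_smul, Real.norm_of_nonneg hs.le]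
      have h5 : ‖t.1 - J c‖ ≤ Real.sqrt (‖t.1 - J c‖ ^ 2 + ‖t.2 - (c - s • J c)‖ ^ 2) :=
        Real.le_sqrt_of_sq_le (by nlinarith [sq_nonneg ‖t.2 - (c - s • J c)‖])
      have h6 : ‖t.2 - (c - s • J c)‖ ≤
          Real.sqrt (‖t.1 - J c‖ ^ 2 + ‖t.2 - (c - s • J c)‖ ^ 2) :=
        Real.le_sqrt_of_sq_le (by nlinarith [sq_nonneg ‖t.1 - J c‖])
      nlinarith
    have h7 : e' / (1 + s) * ‖t.2 + s • t.1 - c‖ ≤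
        e' * Real.sqrt (‖t.1 - J c‖ ^ 2 + ‖t.2 - (c - s • J c)‖ ^ 2) := by
      rw [div_mul_eq_mul_div, div_le_iff₀ (by positivity)]
      nlinarith
    have h8 : ⟪ω, t.2 + s • t.1 - c⟫ =
        ⟪ω, t.2 - (c - s • J c)⟫ + s * ⟪ω, t.1 - J c⟫ := by
      rw [h3, inner_add_right, real_inner_smul_right]
    have h9 : ⟪s • ω - a, t.1 - J c⟫ = s * ⟪ω, t.1 - J c⟫ - (⟪a, t.1⟫ - ⟪a, J c⟫) := by
      rw [inner_sub_left, real_inner_smul_left, ← inner_sub_right a]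
    show ⟪s • ω - a, t.1 - J c⟫ + ⟪ω, t.2 - (c - s • J c)⟫ ≤ _
    rw [h9]
    linarith
  have h1 := hsoc c hc _ _ hcod
  rw [norm_neg, map_neg, inner_neg_neg, inner_neg_right, inner_sub_left, real_inner_smul_left,
    real_inner_self_eq_norm_sq, hinner ω] at h1
  have h2 : ⟪A (d - ω), d - ω⟫ ≤ (s + κ) * ‖d - ω‖ ^ 2 := by
    refine (real_inner_le_norm _ _).trans ?_
    have h3 := A.le_opNorm (d - ω)
    nlinarith [norm_nonneg (d - ω), mul_le_mul_of_nonneg_right hA (norm_nonneg (d - ω))]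
  rw [norm_sub_sq_real, map_sub, inner_sub_left, inner_sub_right _ d ω, inner_sub_right _ d ω] at h2
  have h3 : ⟪a, J y₁⟫ - ⟪a, J y₂⟫ = ⟪a, d⟫ := by rw [hd, inner_sub_right]
  simp only [h3] at hmv
  rw [hinner d, real_inner_self_eq_norm_sq, real_inner_comm (y₁ - y₂) ω] at hmv
  linarith

/-- `J` is a local single-valued inverse of `T + s • id` around `(xb, vh)`, Lipschitz continuous
with constant `1 / σ`, and strongly monotone with modulus `κ` up to the operator `A`. -/
structure StrongResolvent (T : X → Set X) (A : X →L[ℝ] X) (xb vh : X) (s σ κ ρ δ : ℝ)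
    (J : X → X) : Prop where
  mem : ∀ y ∈ ball (vh + s • xb) ρ, y - s • J y ∈ T (J y)
  eq : ∀ u v, ‖u - xb‖ < δ → ‖v - vh‖ < δ → v ∈ T u → v + s • u ∈ ball (vh + s • xb) ρ →
    J (v + s • u) = u
  lip : ∀ y ∈ ball (vh + s • xb) ρ, ∀ y' ∈ ball (vh + s • xb) ρ,
    σ * ‖J y - J y'‖ ≤ ‖y - y'‖
  strong : ∀ y ∈ ball (vh + s • xb) ρ, ∀ y' ∈ ball (vh + s • xb) ρ,
    (s + κ) * ‖J y - J y'‖ ^ 2 - ⟪A (J y - J y'), J y - J y'⟫ ≤ ⟪y - y', J y - J y'⟫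

theorem StrongResolvent.strongMono {T : X → Set X} {A : X →L[ℝ] X} {xb vh : X}
    {s σ κ ρ δ : ℝ} {J : X → X} (hJ : StrongResolvent T A xb vh s σ κ ρ δ J)
    {x₁ w₁ x₂ w₂ : X} (hx₁ : ‖x₁ - xb‖ < δ) (hw₁ : ‖w₁ - vh‖ < δ) (h₁ : w₁ ∈ T x₁)
    (hb₁ : w₁ + s • x₁ ∈ ball (vh + s • xb) ρ) (hx₂ : ‖x₂ - xb‖ < δ) (hw₂ : ‖w₂ - vh‖ < δ)
    (h₂ : w₂ ∈ T x₂) (hb₂ : w₂ + s • x₂ ∈ ball (vh + s • xb) ρ) :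
    κ * ‖x₁ - x₂‖ ^ 2 ≤ ⟪w₁ - w₂, x₁ - x₂⟫ + ⟪A (x₁ - x₂), x₁ - x₂⟫ := by
  have h3 := hJ.strong _ hb₁ _ hb₂
  rw [hJ.eq _ _ hx₁ hw₁ h₁ hb₁, hJ.eq _ _ hx₂ hw₂ h₂ hb₂] at h3
  have h4 : w₁ + s • x₁ - (w₂ + s • x₂) = (w₁ - w₂) + s • (x₁ - x₂) := by
    rw [smul_sub]; abel
  rw [h4, inner_add_left, real_inner_smul_left, real_inner_self_eq_norm_sq] at h3
  linarith

/-- Perturbing the strongly monotone resolvent by a map that is strictly differentiable with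
derivative `A` gives a contraction in the original norm. -/
theorem StrongResolvent.contraction {T : X → Set X} {A : X →L[ℝ] X} {xb vh : X}
    {s σ κ ρ δ : ℝ} {J : X → X} (hJ : StrongResolvent T A xb vh s σ κ ρ δ J) (hs : 0 < s)
    (hκ : 0 < κ) (hA : ‖A‖ ^ 2 ≤ s * κ) {x₁ x₂ y₁ y₂ : X}
    (h₁ : y₁ ∈ ball (vh + s • xb) ρ) (h₂ : y₂ ∈ ball (vh + s • xb) ρ)
    (hy : ‖(y₁ - y₂) - (s • (x₁ - x₂) - A (x₁ - x₂))‖ ≤ κ / 4 * ‖x₁ - x₂‖) :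
    ‖J y₁ - J y₂‖ ≤ Real.sqrt ((s + κ / 4) / (s + 3 * κ / 4)) * ‖x₁ - x₂‖ := by
  have h3 := hJ.strong _ h₁ _ h₂
  set d := J y₁ - J y₂
  set x := x₁ - x₂
  set e := (y₁ - y₂) - (s • x - A x) with he
  have h4 : ⟪y₁ - y₂, d⟫ = ⟪e, d⟫ + s * ⟪x, d⟫ - ⟪A (x - d), d⟫ - ⟪A d, d⟫ := by
    have h5 : ⟪A (x - d), d⟫ = ⟪A x, d⟫ - ⟪A d, d⟫ := by
      rw [A.map_sub x d, inner_sub_left (A x)]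
    rw [he, inner_sub_left (y₁ - y₂), inner_sub_left (s • x), real_inner_smul_left, h5]
    ring
  have h5 : ⟪e, d⟫ ≤ κ / 4 * ‖x‖ * ‖d‖ :=
    (real_inner_le_norm _ _).trans (mul_le_mul_of_nonneg_right hy (norm_nonneg _))
  have h6 : -⟪A (x - d), d⟫ ≤ ‖A‖ * ‖x - d‖ * ‖d‖ :=
    (neg_le_abs _).trans ((abs_real_inner_le_norm _ _).trans
      (mul_le_mul_of_nonneg_right (A.le_opNorm _) (norm_nonneg _)))
  have h7 := norm_sub_sq_real x d
  have h8 : ‖A‖ * ‖x - d‖ * ‖d‖ ≤ s / 2 * ‖x - d‖ ^ 2 + κ / 2 * ‖d‖ ^ 2 := by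
    have h9 : 0 ≤ (s * ‖x - d‖ - ‖A‖ * ‖d‖) ^ 2 := sq_nonneg _
    have h10 : ‖A‖ ^ 2 * ‖d‖ ^ 2 ≤ s * κ * ‖d‖ ^ 2 :=
      mul_le_mul_of_nonneg_right hA (sq_nonneg _)
    refine le_of_mul_le_mul_left ?_ hs
    nlinarith
  have h9 : κ / 4 * ‖x‖ * ‖d‖ ≤ κ / 8 * ‖x‖ ^ 2 + κ / 8 * ‖d‖ ^ 2 := by
    nlinarith [sq_nonneg (‖x‖ - ‖d‖)]
  have h10 : (s + 3 * κ / 4) * ‖d‖ ^ 2 ≤ (s + κ / 4) * ‖x‖ ^ 2 := by nlinarith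
  rw [← Real.sqrt_sq (norm_nonneg x), ← Real.sqrt_mul (by positivity)]
  refine Real.le_sqrt_of_sq_le ?_
  rw [div_mul_eq_mul_div, le_div_iff₀ (by positivity)]
  linarith

/-- Banach's fixed point theorem on a closed ball, for a map moving the center slightly. -/
theorem exists_fixedPoint_closedBall {E : Type*} [NormedAddCommGroup E] [CompleteSpace E]
    {Φ : E → E} {c : E} {k t : ℝ}
    (hk₀ : 0 ≤ k) (hk : k < 1) (ht : 0 ≤ t)
    (hΦ : ∀ x ∈ closedBall c t, ∀ x' ∈ closedBall c t, ‖Φ x - Φ x'‖ ≤ k * ‖x - x'‖)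
    (hc : ‖Φ c - c‖ ≤ (1 - k) * t) : ∃ x ∈ closedBall c t, Φ x = x := by
  have hcm : c ∈ closedBall c t := mem_closedBall_self ht
  have hmaps : MapsTo Φ (closedBall c t) (closedBall c t) := by
    intro x hx
    have h1 := hΦ x hx c hcm
    have h2 := norm_sub_le_norm_sub_add_norm_sub (Φ x) (Φ c) c
    rw [mem_closedBall_iff_norm] at hx ⊢
    nlinarith
  have hcon : ContractingWith ⟨k, hk₀⟩ (hmaps.restrict Φ _ _) := by
    refine ⟨hk, LipschitzWith.of_dist_le_mul fun x y => ?_⟩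
    have h1 := hΦ x x.2 y y.2
    rw [← dist_eq_norm, ← dist_eq_norm] at h1
    exact h1
  obtain ⟨x, hx, hfix, -⟩ := hcon.exists_fixedPoint' isClosed_closedBall.isComplete hmaps hcm
    (edist_ne_top _ _)
  exact ⟨x, hx, hfix⟩

/-- Prox-regularity together with the coderivative condition produces a strongly monotone
resolvent near any graph point close to the reference one. -/
theorem exists_strongResolvent [CompleteSpace X] {h : X → EReal} (hlsc : LowerSemicontinuous h)
    (hbot : ∀ x, h x ≠ ⊥) {xb vh : X} {A : X →L[ℝ] X} {ε r s R κ : ℝ} (hr : 0 < r) (hrs : r < s)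
    (hR : 0 < R) (hA : ‖A‖ ≤ s + κ) (hRε : 2 * R < ε) (hsR : 3 * s * R < ε)
    (hprox : ∀ x u v, ‖x - xb‖ < ε → ‖u - xb‖ < ε → ‖v - vh‖ < ε → v ∈ limSubdiff h u →
      h u + ((⟪v, x - u⟫ - r / 2 * ‖x - u‖ ^ 2 : ℝ) : EReal) ≤ h x)
    (hsoc : ∀ u v, ‖u - xb‖ < ε → ‖v - vh‖ < ε → v ∈ limSubdiff h u →
      ∀ w z, z ∈ regCoderiv (limSubdiff h) u v w → κ * ‖w‖ ^ 2 ≤ ⟪A w, w⟫ + ⟪z, w⟫)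
    {x₀ v₀ : X} (h₀ : v₀ ∈ limSubdiff h x₀)
    (hclose : ‖v₀ - vh‖ + s * ‖x₀ - xb‖ ≤ (s - r) * R / 16) :
    ∃ J : X → X, StrongResolvent (limSubdiff h) A xb vh s (s - r) κ ((s - r) * R / 16) ε J := by
  have hs0 : 0 < s := hr.trans hrs
  have hsr : 0 < s - r := sub_pos.2 hrs
  have hsR0 : 0 < s * R := mul_pos hs0 hR
  have hrR0 : 0 < r * R := mul_pos hr hR
  have hx₀ : ‖x₀ - xb‖ < R := by
    refine lt_of_mul_lt_mul_left ?_ hs0.le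
    nlinarith [norm_nonneg (v₀ - vh)]
  have hv₀ : ‖v₀ - vh‖ < s * R := by nlinarith [norm_nonneg (x₀ - xb)]
  have hyc : ‖(v₀ + s • x₀) - (vh + s • xb)‖ ≤ (s - r) * R / 16 := by
    have h1 : (v₀ + s • x₀) - (vh + s • xb) = (v₀ - vh) + s • (x₀ - xb) := by
      rw [smul_sub]; abel
    rw [h1]
    refine (norm_add_le _ _).trans ?_
    rwa [norm_smul, Real.norm_of_nonneg hs0.le]
  obtain ⟨J, hJ⟩ := exists_local_resolvent hlsc hbot hr hrs hR hprox h₀ (by linarith)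
    (by linarith) hyc
  have hJx : ∀ y ∈ ball (vh + s • xb) ((s - r) * R / 16), ‖J y - xb‖ < ε := fun y hy => by
    have h1 := norm_sub_le_norm_sub_add_norm_sub (J y) x₀ xb
    have h2 := (hJ y hy).2.1
    linarith
  have hJv : ∀ y ∈ ball (vh + s • xb) ((s - r) * R / 16), ‖y - s • J y - vh‖ < ε :=
    fun y hy => by
      have h1 := norm_sub_le_norm_sub_add_norm_sub (y - s • J y) v₀ vh
      have h2 := (hJ y hy).2.2
      linarith
  have hlip : ∀ y ∈ ball (vh + s • xb) ((s - r) * R / 16),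
      ∀ y' ∈ ball (vh + s • xb) ((s - r) * R / 16), (s - r) * ‖J y - J y'‖ ≤ ‖y - y'‖ := by
    intro y hy y' hy'
    simpa using limSubdiff_resolvent_lipschitz (s := s) hbot hprox (hJx y hy) (hJv y hy)
      (hJ y hy).1 (hJx y' hy') (hJv y' hy') (hJ y' hy').1
  have heq : ∀ u v, ‖u - xb‖ < ε → ‖v - vh‖ < ε → v ∈ limSubdiff h u →
      v + s • u ∈ ball (vh + s • xb) ((s - r) * R / 16) → J (v + s • u) = u := by
    intro u v hu hv hm hy
    have h1 := limSubdiff_resolvent_lipschitz (s := s) hbot hprox (hJx _ hy) (hJv _ hy)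
      (hJ _ hy).1 hu hv hm
    rw [sub_add_cancel, sub_self, norm_zero] at h1
    have h2 : ‖J (v + s • u) - u‖ ≤ 0 := by
      by_contra! h3
      nlinarith
    exact sub_eq_zero.1 (norm_le_zero_iff.1 h2)
  refine ⟨J, fun y hy => (hJ y hy).1, heq, hlip, fun y hy y' hy' =>
    strong_inequality_of_coderivative hs0 hsr hA hlip (fun y hy => ?_) (fun y hy w z hz =>
      hsoc _ _ (hJx y hy) (hJv y hy) (hJ y hy).1 w z hz) hy hy'⟩
  have h1 : Continuous fun t : X × X => ‖t.1 - xb‖ := by fun_prop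
  have h2 : Continuous fun t : X × X => ‖t.2 - vh‖ := by fun_prop
  have h3 : Continuous fun t : X × X => t.2 + s • t.1 := by fun_prop
  have h4 : Tendsto (fun t : X × X => t.2 + s • t.1) (𝓝 (J y, y - s • J y)) (𝓝 y) := by
    simpa using h3.tendsto (J y, y - s • J y)
  filter_upwards [(h1.tendsto (J y, y - s • J y)).eventually_lt_const (hJx y hy),
    (h2.tendsto (J y, y - s • J y)).eventually_lt_const (hJv y hy),
    h4 (isOpen_ball.mem_nhds hy)] with t ht1 ht2 ht3 htm
  exact heq _ _ ht1 ht2 htm ht3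

/-- Partial differentiability with continuous Jacobian, uniformly in the parameters, implies
strict differentiability in the decision variable, uniformly in the parameters. -/
theorem A4.strict {f : X → P → Q → X} {Df : X → P → Q → X →L[ℝ] X} {xb : X} {pb : P} {qb : Q}
    (h : A4 f Df xb pb qb) {e : ℝ} (he : 0 < e) :
    ∃ δ > (0:ℝ), ∀ x₁ x₂ p q, ‖x₁ - xb‖ < δ → ‖x₂ - xb‖ < δ → dist p pb < δ → dist q qb < δ →
      ‖f x₁ p q - f x₂ p q - Df xb pb qb (x₁ - x₂)‖ ≤ e * ‖x₁ - x₂‖ := by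
  obtain ⟨⟨η, hη, hunif⟩, hcont⟩ := h
  obtain ⟨δ, hδ, hf⟩ := hunif (e / 2) (by positivity)
  obtain ⟨γ, hγ, hD⟩ := Metric.tendsto_nhds_nhds.1 hcont (e / 2) (by positivity)
  refine ⟨min η (min (δ / 2) γ), by positivity, fun x₁ x₂ p q h₁ h₂ hp hq => ?_⟩
  simp only [lt_min_iff] at h₁ h₂ hp hq
  have h12 : ‖x₁ - x₂‖ < δ := by
    have h3 := norm_sub_le_norm_sub_add_norm_sub x₁ xb x₂
    rw [norm_sub_rev xb] at h3
    linarith [h₁.2.1, h₂.2.1]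
  have h3 := hf x₂ p q h₂.1 hp.1 hq.1 x₁ h12
  have h4 : ‖Df x₂ p q - Df xb pb qb‖ < e / 2 := by
    have h5 := hD (x := (x₂, p, q)) (by
      simp only [Prod.dist_eq, sup_lt_iff, dist_eq_norm]
      exact ⟨h₂.2.2, hp.2.2, hq.2.2⟩)
    rwa [dist_eq_norm] at h5
  have h5 : f x₁ p q - f x₂ p q - Df xb pb qb (x₁ - x₂) =
      (f x₁ p q - f x₂ p q - Df x₂ p q (x₁ - x₂)) + (Df x₂ p q - Df xb pb qb) (x₁ - x₂) := by
    rw [sub_apply]; abel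
  rw [h5]
  refine (norm_add_le _ _).trans ?_
  have h6 := (Df x₂ p q - Df xb pb qb).le_opNorm (x₁ - x₂)
  nlinarith [norm_nonneg (x₁ - x₂)]

/-- A strong monotonicity estimate in the form used for full stability. -/
theorem norm_sub_two_smul_le_of_inner {v x : X} {κ : ℝ} (hκ : 0 ≤ κ)
    (h : κ * ‖x‖ ^ 2 ≤ ⟪v, x⟫) : ‖v - (2 * κ) • x‖ ≤ ‖v‖ := by
  refine le_of_sq_le_sq ?_ (norm_nonneg _)
  rw [norm_sub_sq_real, real_inner_smul_right, norm_smul, Real.norm_of_nonneg (by positivity)]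
  nlinarith

/-- Solutions of `v ∈ F x + T x` in a window depend strongly monotonically on `v`. -/
theorem StrongResolvent.solution_strongMono {T : X → Set X} {F : X → X} {A : X →L[ℝ] X}
    {xb vb vh : X} {s σ κ ρ δ γ c : ℝ} {J : X → X}
    (hJ : StrongResolvent T A xb vh s σ κ ρ δ J) (hs : 0 ≤ s) (hγδ : γ + c ≤ δ) (hc : 0 ≤ c)
    (hγρ : γ + c + s * γ ≤ ρ) (hκ : 0 ≤ κ)
    (hF : ∀ x, ‖x - xb‖ < γ → ‖F x - (vb - vh)‖ ≤ c)
    (hFA : ∀ x₁ x₂, ‖x₁ - xb‖ < γ → ‖x₂ - xb‖ < γ →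
      ‖F x₁ - F x₂ - A (x₁ - x₂)‖ ≤ κ / 4 * ‖x₁ - x₂‖)
    {x₁ v₁ x₂ v₂ : X} (hx₁ : ‖x₁ - xb‖ < γ) (hv₁ : ‖v₁ - vb‖ < γ) (h₁ : v₁ - F x₁ ∈ T x₁)
    (hx₂ : ‖x₂ - xb‖ < γ) (hv₂ : ‖v₂ - vb‖ < γ) (h₂ : v₂ - F x₂ ∈ T x₂) :
    κ / 2 * ‖x₁ - x₂‖ ^ 2 ≤ ⟪v₁ - v₂, x₁ - x₂⟫ := by
  have hw : ∀ x v, ‖x - xb‖ < γ → ‖v - vb‖ < γ → ‖v - F x - vh‖ < γ + c := by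
    intro x v hx hv
    have h1 : v - F x - vh = (v - vb) - (F x - (vb - vh)) := by abel
    rw [h1]
    refine (norm_sub_le _ _).trans_lt ?_
    linarith [hF x hx]
  have hb : ∀ x v, ‖x - xb‖ < γ → ‖v - vb‖ < γ → v - F x + s • x ∈ ball (vh + s • xb) ρ := by
    intro x v hx hv
    have h1 : v - F x + s • x - (vh + s • xb) = (v - F x - vh) + s • (x - xb) := by
      rw [smul_sub]; abel
    rw [mem_ball_iff_norm, h1]
    refine (norm_add_le _ _).trans_lt ?_
    rw [norm_smul, Real.norm_of_nonneg hs]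
    linarith [hw x v hx hv, mul_le_mul_of_nonneg_left hx.le hs]
  have h3 := hJ.strongMono (by linarith) ((hw x₁ v₁ hx₁ hv₁).trans_le hγδ) h₁
    (hb x₁ v₁ hx₁ hv₁) (by linarith) ((hw x₂ v₂ hx₂ hv₂).trans_le hγδ) h₂ (hb x₂ v₂ hx₂ hv₂)
  have h4 := hFA x₁ x₂ hx₁ hx₂
  have h5 := (abs_le.1 (abs_real_inner_le_norm (F x₁ - F x₂ - A (x₁ - x₂)) (x₁ - x₂))).1
  have h6 : ⟪v₁ - v₂, x₁ - x₂⟫ = ⟪v₁ - F x₁ - (v₂ - F x₂), x₁ - x₂⟫ +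
      ⟪A (x₁ - x₂), x₁ - x₂⟫ + ⟪F x₁ - F x₂ - A (x₁ - x₂), x₁ - x₂⟫ := by
    rw [← inner_add_left, ← inner_add_left]
    congr 1; abel
  have h7 := mul_le_mul_of_nonneg_right h4 (norm_nonneg (x₁ - x₂))
  have h8 : 0 ≤ κ * ‖x₁ - x₂‖ ^ 2 := by positivity
  linarith

/-- Solvability of `v ∈ F x + T x` near the reference point. -/
theorem StrongResolvent.exists_solution [CompleteSpace X] {T : X → Set X} {F : X → X}
    {A : X →L[ℝ] X} {xb vb vh : X} {s σ κ ρ δ t c k : ℝ} {J : X → X}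
    (hJ : StrongResolvent T A xb vh s σ κ ρ δ J) (hs : 0 < s) (hσ : 0 < σ) (hκ : 0 < κ)
    (hA : ‖A‖ ^ 2 ≤ s * κ) (ht : 0 ≤ t) (hk : k = Real.sqrt ((s + κ / 4) / (s + 3 * κ / 4)))
    (hF : ∀ x ∈ closedBall xb t, ‖F x - (vb - vh)‖ ≤ c)
    (hFA : ∀ x₁ ∈ closedBall xb t, ∀ x₂ ∈ closedBall xb t,
      ‖F x₁ - F x₂ - A (x₁ - x₂)‖ ≤ κ / 4 * ‖x₁ - x₂‖)
    {v x₀ w₀ : X} (hv : ‖v - vb‖ + c + s * t < ρ) (h₀ : w₀ ∈ T x₀) (hx₀ : ‖x₀ - xb‖ < δ)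
    (hw₀ : ‖w₀ - vh‖ < δ) (h₀ρ : ‖w₀ - vh‖ + s * ‖x₀ - xb‖ < ρ)
    (hcen : (‖v - vb‖ + ‖F xb - (vb - vh)‖ + ‖w₀ - vh‖ + s * ‖x₀ - xb‖) / σ + ‖x₀ - xb‖ ≤
      (1 - k) * t) :
    ∃ x ∈ closedBall xb t, v - F x ∈ T x := by
  have hk0 : 0 ≤ k := hk ▸ Real.sqrt_nonneg _
  have hk1 : k < 1 := by
    rw [hk, Real.sqrt_lt' one_pos, one_pow, div_lt_one (by positivity)]
    linarith
  have hball : ∀ x ∈ closedBall xb t, v - F x + s • x ∈ ball (vh + s • xb) ρ := by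
    intro x hx
    have h1 : v - F x + s • x - (vh + s • xb) =
        (v - vb) - (F x - (vb - vh)) + s • (x - xb) := by
      rw [smul_sub]; abel
    have h2 := hF x hx
    rw [mem_closedBall_iff_norm] at hx
    rw [mem_ball_iff_norm, h1]
    refine (norm_add_le _ _).trans_lt ?_
    rw [norm_smul, Real.norm_of_nonneg hs.le]
    linarith [norm_sub_le (v - vb) (F x - (vb - vh)), mul_le_mul_of_nonneg_left hx hs.le]
  have hcon : ∀ x ∈ closedBall xb t, ∀ x' ∈ closedBall xb t,
      ‖J (v - F x + s • x) - J (v - F x' + s • x')‖ ≤ k * ‖x - x'‖ := by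
    intro x hx x' hx'
    rw [hk]
    refine hJ.contraction hs hκ hA (hball x hx) (hball x' hx') ?_
    have h1 : v - F x + s • x - (v - F x' + s • x') - (s • (x - x') - A (x - x')) =
        -(F x - F x' - A (x - x')) := by
      rw [smul_sub]; abel
    rw [h1, norm_neg]
    exact hFA x hx x' hx'
  have hb₀ : w₀ + s • x₀ ∈ ball (vh + s • xb) ρ := by
    have h1 : w₀ + s • x₀ - (vh + s • xb) = (w₀ - vh) + s • (x₀ - xb) := by
      rw [smul_sub]; abel
    rw [mem_ball_iff_norm, h1]
    refine (norm_add_le _ _).trans_lt ?_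
    rwa [norm_smul, Real.norm_of_nonneg hs.le]
  have h1 := hJ.lip _ (hball xb (mem_closedBall_self ht)) _ hb₀
  rw [hJ.eq x₀ w₀ hx₀ hw₀ h₀ hb₀] at h1
  have h2 : v - F xb + s • xb - (w₀ + s • x₀) =
      (v - vb) - (F xb - (vb - vh)) - (w₀ - vh) - s • (x₀ - xb) := by
    rw [smul_sub]; abel
  have h3 : ‖v - F xb + s • xb - (w₀ + s • x₀)‖ ≤
      ‖v - vb‖ + ‖F xb - (vb - vh)‖ + ‖w₀ - vh‖ + s * ‖x₀ - xb‖ := by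
    rw [h2]
    have h6 := norm_sub_le ((v - vb) - (F xb - (vb - vh)) - (w₀ - vh)) (s • (x₀ - xb))
    have h7 := norm_sub_le ((v - vb) - (F xb - (vb - vh))) (w₀ - vh)
    have h8 := norm_sub_le (v - vb) (F xb - (vb - vh))
    rw [norm_smul, Real.norm_of_nonneg hs.le] at h6
    linarith
  have h4 : ‖J (v - F xb + s • xb) - x₀‖ ≤
      (‖v - vb‖ + ‖F xb - (vb - vh)‖ + ‖w₀ - vh‖ + s * ‖x₀ - xb‖) / σ := by
    rw [le_div_iff₀ hσ]; linarith
  have h5 := norm_sub_le_norm_sub_add_norm_sub (J (v - F xb + s • xb)) x₀ xb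
  obtain ⟨x, hx, hfix⟩ := exists_fixedPoint_closedBall hk0 hk1 ht hcon (h5.trans (by linarith))
  refine ⟨x, hx, ?_⟩
  have h1 := hJ.mem _ (hball x hx)
  rwa [hfix, add_sub_cancel_right] at h1

set_option maxHeartbeats 400000 in
/-- Full stability from uniformly strongly monotone resolvents. -/
theorem lipFullStable_of_strongResolvent [CompleteSpace X] {f : X → P → Q → X}
    {T : P → X → Set X} {A : X →L[ℝ] X} {xb vb vh : X} {pb : P} {qb : Q}
    {s σ κ ρ δ L ℓ : ℝ} {J : P → X → X} (hvh : vh = vb - f xb pb qb)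
    (hs : 0 < s) (hσ : 0 < σ) (hκ : 0 < κ) (hA : ‖A‖ ^ 2 ≤ s * κ) (hρ : 0 < ρ) (hδ : 0 < δ)
    (hL : 0 < L) (hℓ : 0 < ℓ)
    (hmem : vh ∈ T pb xb)
    (hJ : ∀ p, dist p pb < δ → StrongResolvent (T p) A xb vh s σ κ ρ δ (J p))
    (hT : ∀ p p', dist p pb < δ → dist p' pb < δ → ∀ x w, ‖x - xb‖ < δ → ‖w - vh‖ < δ →
      w ∈ T p x → ∃ x' w', w' ∈ T p' x' ∧ ‖x - x'‖ ≤ ℓ * dist p p' ∧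
        ‖w - w'‖ ≤ ℓ * dist p p')
    (hf : ∀ x₁ x₂ p₁ p₂ q₁ q₂, ‖x₁ - xb‖ < δ → ‖x₂ - xb‖ < δ → dist p₁ pb < δ →
      dist p₂ pb < δ → dist q₁ qb < δ → dist q₂ qb < δ →
      ‖f x₁ p₁ q₁ - f x₂ p₂ q₂‖ ≤ L * (‖x₁ - x₂‖ + dist p₁ p₂ + dist q₁ q₂))
    (hfA : ∀ x₁ x₂ p q, ‖x₁ - xb‖ < δ → ‖x₂ - xb‖ < δ → dist p pb < δ → dist q qb < δ →
      ‖f x₁ p q - f x₂ p q - A (x₁ - x₂)‖ ≤ κ / 4 * ‖x₁ - x₂‖) :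
    LipFullStable (fun v p q => {x | v - f x p q ∈ T p x}) xb vb pb qb := by
  have hfb : ∀ x p q, ‖x - xb‖ < δ → dist p pb < δ → dist q qb < δ →
      ‖f x p q - f xb pb qb‖ ≤ L * (‖x - xb‖ + dist p pb + dist q qb) := fun x p q hx hp hq =>
    hf x xb p pb q qb hx (by simpa) hp (by simpa) hq (by simpa)
  have hfb' : ∀ x p q, ‖x - xb‖ < δ → dist p pb < δ → dist q qb < δ → ∀ e, ‖x - xb‖ ≤ e →
      dist p pb ≤ e → dist q qb ≤ e → ‖f x p q - (vb - vh)‖ ≤ L * (3 * e) := by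
    intro x p q hx hp hq e hxe hpe hqe
    rw [hvh, sub_sub_cancel]
    exact (hfb x p q hx hp hq).trans (mul_le_mul_of_nonneg_left (by linarith) hL.le)
  -- strong monotonicity of the solution graph in a window of size `γ`
  have hmono : ∃ γ, 0 < γ ∧ γ ≤ δ ∧ ∀ p q, dist p pb < γ → dist q qb < γ → ∀ x₁ v₁ x₂ v₂,
      ‖x₁ - xb‖ < γ → ‖v₁ - vb‖ < γ → v₁ - f x₁ p q ∈ T p x₁ →
      ‖x₂ - xb‖ < γ → ‖v₂ - vb‖ < γ → v₂ - f x₂ p q ∈ T p x₂ →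
      κ / 2 * ‖x₁ - x₂‖ ^ 2 ≤ ⟪v₁ - v₂, x₁ - x₂⟫ := by
    have h1 : Tendsto (fun γ : ℝ => γ + L * (3 * γ)) (𝓝[>] 0) (𝓝 0) :=
      (Continuous.tendsto' (by fun_prop) 0 0 (by simp)).mono_left nhdsWithin_le_nhds
    have h2 : Tendsto (fun γ : ℝ => γ + L * (3 * γ) + s * γ) (𝓝[>] 0) (𝓝 0) :=
      (Continuous.tendsto' (by fun_prop) 0 0 (by simp)).mono_left nhdsWithin_le_nhds
    obtain ⟨γ, hγ, hγδ, hγρ⟩ := (eventually_mem_nhdsWithin.and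
      ((h1.eventually_lt_const hδ).and (h2.eventually_lt_const hρ))).exists
    have hγ0 : 0 < γ := hγ
    have hLγ : 0 < L * γ := by positivity
    have hγδ' : γ < δ := by linarith
    refine ⟨γ, hγ, hγδ'.le, fun p q hp hq x₁ v₁ x₂ v₂ hx₁ hv₁ h₁ hx₂ hv₂ h₂ => ?_⟩
    exact (hJ p (hp.trans hγδ')).solution_strongMono (F := fun x => f x p q) hs.le hγδ.le
      (by positivity) hγρ.le hκ.le
      (fun x hx => hfb' x p q (hx.trans hγδ') (hp.trans hγδ') (hq.trans hγδ') γ hx.le hp.le hq.le)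
      (fun x₁ x₂ hx₁ hx₂ => hfA x₁ x₂ p q (hx₁.trans hγδ') (hx₂.trans hγδ') (hp.trans hγδ')
        (hq.trans hγδ')) hx₁ hv₁ h₁ hx₂ hv₂ h₂
  obtain ⟨γ, hγ, hγδ, hmono⟩ := hmono
  -- radius of the neighborhood of solutions
  obtain ⟨t, ht, htγ, htρ⟩ : ∃ t, 0 < t ∧ t * (2 + 2 * ℓ + L * (2 * ℓ + 4)) < γ ∧
      t * (2 + 3 * L + s + (1 + s) * ℓ) < ρ := by
    have h1 : Tendsto (fun t : ℝ => t * (2 + 2 * ℓ + L * (2 * ℓ + 4))) (𝓝[>] 0) (𝓝 0) := by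
      exact (Continuous.tendsto' (by fun_prop) 0 0 (by simp)).mono_left nhdsWithin_le_nhds
    have h2 : Tendsto (fun t : ℝ => t * (2 + 3 * L + s + (1 + s) * ℓ)) (𝓝[>] 0) (𝓝 0) := by
      exact (Continuous.tendsto' (by fun_prop) 0 0 (by simp)).mono_left nhdsWithin_le_nhds
    exact (eventually_mem_nhdsWithin.and
      ((h1.eventually_lt_const hγ).and (h2.eventually_lt_const hρ))).exists
  have hLt : 0 < L * t := by positivity
  have hℓt : 0 < ℓ * t := by positivity
  have hst : 0 < s * t := by positivity
  have hLℓt : 0 < L * (ℓ * t) := by positivity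
  have hsℓt : 0 < s * (ℓ * t) := by positivity
  set k := Real.sqrt ((s + κ / 4) / (s + 3 * κ / 4)) with hk
  have hk1 : k < 1 := by
    rw [hk, Real.sqrt_lt' one_pos, one_pow, div_lt_one (by positivity)]
    linarith
  obtain ⟨μ, hμ, hμt, hμk⟩ : ∃ μ, 0 < μ ∧ μ < t ∧
      μ * (1 + 3 * L + (1 + s) * ℓ) / σ + ℓ * μ < (1 - k) * t := by
    have h1 : Tendsto (fun μ : ℝ => μ * (1 + 3 * L + (1 + s) * ℓ) / σ + ℓ * μ) (𝓝[>] 0)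
        (𝓝 0) := by
      exact (Continuous.tendsto' (by fun_prop) 0 0 (by simp)).mono_left nhdsWithin_le_nhds
    exact (eventually_mem_nhdsWithin.and ((Tendsto.eventually_lt_const ht (tendsto_id.mono_left nhdsWithin_le_nhds)).and
      (h1.eventually_lt_const (mul_pos (by linarith) ht)))).exists
  have htd : t < γ := by linarith
  have hexists : ∀ v ∈ ball vb μ, ∀ p ∈ ball pb μ, ∀ q ∈ ball qb μ,
      ∃ x ∈ closedBall xb t, v - f x p q ∈ T p x := by
    intro v hv p hp q hq
    rw [mem_ball_iff_norm] at hv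
    rw [mem_ball] at hp hq
    have hpδ : dist p pb < δ := by linarith
    have hqδ : dist q qb < δ := by linarith
    have hcb : ∀ x ∈ closedBall xb t, ‖x - xb‖ ≤ t ∧ ‖x - xb‖ < δ := fun x hx => by
      rw [mem_closedBall_iff_norm] at hx
      exact ⟨hx, by linarith⟩
    obtain ⟨x₀, w₀, hm₀, hx₀, hw₀⟩ := hT pb p (by simpa) hpδ xb vh (by simpa) (by simpa) hmem
    rw [norm_sub_rev, dist_comm] at hx₀ hw₀
    have h0 : ℓ * dist p pb ≤ ℓ * μ := mul_le_mul_of_nonneg_left hp.le hℓ.le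
    have h1 : ℓ * μ < ℓ * t := mul_lt_mul_of_pos_left hμt hℓ
    have h2 : s * ‖x₀ - xb‖ ≤ s * (ℓ * μ) := mul_le_mul_of_nonneg_left (hx₀.trans h0) hs.le
    have h3 : s * (ℓ * μ) < s * (ℓ * t) := mul_lt_mul_of_pos_left h1 hs
    refine (hJ p hpδ).exists_solution (F := fun x => f x p q) hs hσ hκ hA ht.le hk
      (fun x hx => hfb' x p q (hcb x hx).2 hpδ hqδ t (hcb x hx).1 (by linarith) (by linarith))
      (fun x₁ hx₁ x₂ hx₂ => hfA x₁ x₂ p q (hcb x₁ hx₁).2 (hcb x₂ hx₂).2 hpδ hqδ)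
      (by linarith) hm₀ (by linarith) (by linarith) (by linarith) ?_
    have h4 := hfb' xb p q (by simpa) hpδ hqδ μ (by simpa using hμ.le) hp.le hq.le
    refine le_trans (add_le_add (div_le_div_of_nonneg_right ?_ hσ.le) (hx₀.trans h0)) hμk.le
    linarith
  have hsel : ∀ v p q, ∃ x, v ∈ ball vb μ → p ∈ ball pb μ → q ∈ ball qb μ →
      x ∈ closedBall xb t ∧ v - f x p q ∈ T p x := by
    intro v p q
    by_cases h : v ∈ ball vb μ ∧ p ∈ ball pb μ ∧ q ∈ ball qb μ
    · obtain ⟨x, hx⟩ := hexists v h.1 p h.2.1 q h.2.2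
      exact ⟨x, fun _ _ _ => hx⟩
    · exact ⟨xb, fun h1 h2 h3 => absurd ⟨h1, h2, h3⟩ h⟩
  choose ϑ hϑ using hsel
  refine ⟨ball vb μ, ball_mem_nhds _ hμ, ball pb μ, ball_mem_nhds _ hμ, ball qb μ,
    ball_mem_nhds _ hμ, closedBall xb t, closedBall_mem_nhds _ ht, ϑ, ?_, κ / 2, by positivity,
    2 * (ℓ + L * (ℓ + 1)) + κ * ℓ, by positivity, ?_⟩
  · intro v hv p hp q hq
    obtain ⟨h1, h2⟩ := hϑ v p q hv hp hq
    refine ⟨h1, h2, fun x hx hxS => ?_⟩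
    rw [mem_ball_iff_norm] at hv
    rw [mem_ball] at hp hq
    rw [mem_closedBall_iff_norm] at hx h1
    have h3 := hmono p q (by linarith) (by linarith) x v (ϑ v p q) v (by linarith) (by linarith)
      hxS (by linarith) (by linarith) h2
    rw [sub_self, inner_zero_left] at h3
    have h4 : ‖x - ϑ v p q‖ ^ 2 ≤ 0 := nonpos_of_mul_nonpos_right h3 (by positivity)
    exact sub_eq_zero.1 (norm_eq_zero.1 (pow_eq_zero_iff two_ne_zero |>.1
      (le_antisymm h4 (sq_nonneg _))))
  · intro v₁ hv₁ p₁ hp₁ q₁ hq₁ v₂ hv₂ p₂ hp₂ q₂ hq₂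
    obtain ⟨hx₁, hm₁⟩ := hϑ v₁ p₁ q₁ hv₁ hp₁ hq₁
    obtain ⟨hx₂, hm₂⟩ := hϑ v₂ p₂ q₂ hv₂ hp₂ hq₂
    set x₁ := ϑ v₁ p₁ q₁
    set x₂ := ϑ v₂ p₂ q₂
    rw [mem_ball_iff_norm] at hv₁ hv₂
    rw [mem_ball] at hp₁ hq₁ hp₂ hq₂
    rw [mem_closedBall_iff_norm] at hx₁ hx₂
    have hw₁ : ‖v₁ - f x₁ p₁ q₁ - vh‖ < δ := by
      have h1 : v₁ - f x₁ p₁ q₁ - vh = (v₁ - vb) - (f x₁ p₁ q₁ - f xb pb qb) := by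
        rw [hvh]; abel
      have h2 := hfb x₁ p₁ q₁ (by linarith) (by linarith) (by linarith)
      have h3 : L * (‖x₁ - xb‖ + dist p₁ pb + dist q₁ qb) ≤ L * (3 * t) :=
        mul_le_mul_of_nonneg_left (by linarith) hL.le
      rw [h1]
      refine (norm_sub_le _ _).trans_lt ?_
      linarith
    obtain ⟨x', w', hm', hx', hw'⟩ := hT p₁ p₂ (by linarith) (by linarith) x₁
      (v₁ - f x₁ p₁ q₁) (by linarith) hw₁ hm₁
    have hpp : dist p₁ p₂ < 2 * t := by
      have := dist_triangle_right p₁ p₂ pb; linarith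
    have hqq : dist q₁ q₂ < 2 * t := by
      have := dist_triangle_right q₁ q₂ qb; linarith
    have hp0 : 0 ≤ dist p₁ p₂ := dist_nonneg
    have hq0 : 0 ≤ dist q₁ q₂ := dist_nonneg
    have hℓp : ℓ * dist p₁ p₂ < ℓ * (2 * t) := mul_lt_mul_of_pos_left hpp hℓ
    have hx'b : ‖x' - xb‖ < t + 2 * (ℓ * t) := by
      have h1 := norm_sub_le_norm_sub_add_norm_sub x' x₁ xb
      rw [norm_sub_rev x' x₁] at h1
      linarith
    have hx'γ : ‖x' - xb‖ < γ := by linarith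
    have hvv : ‖v₁ - (w' + f x' p₂ q₂)‖ ≤
        (ℓ + L * (ℓ + 1)) * dist p₁ p₂ + L * dist q₁ q₂ := by
      have h1 : v₁ - (w' + f x' p₂ q₂) =
          (v₁ - f x₁ p₁ q₁ - w') + (f x₁ p₁ q₁ - f x' p₂ q₂) := by abel
      have h2 := hf x₁ x' p₁ p₂ q₁ q₂ (by linarith) (by linarith) (by linarith) (by linarith)
        (by linarith) (by linarith)
      have h3 : L * (‖x₁ - x'‖ + dist p₁ p₂ + dist q₁ q₂) ≤
          L * (ℓ * dist p₁ p₂ + dist p₁ p₂ + dist q₁ q₂) :=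
        mul_le_mul_of_nonneg_left (by linarith) hL.le
      rw [h1]
      refine (norm_add_le _ _).trans ?_
      linarith
    have hv'γ : ‖w' + f x' p₂ q₂ - vb‖ < γ := by
      have h1 := norm_sub_le_norm_sub_add_norm_sub (w' + f x' p₂ q₂) v₁ vb
      rw [norm_sub_rev _ v₁] at h1
      have h2 : (ℓ + L * (ℓ + 1)) * dist p₁ p₂ ≤ (ℓ + L * (ℓ + 1)) * (2 * t) :=
        mul_le_mul_of_nonneg_left hpp.le (by positivity)
      have h3 : L * dist q₁ q₂ ≤ L * (2 * t) := mul_le_mul_of_nonneg_left hqq.le hL.le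
      linarith
    have h1 := hmono p₂ q₂ (by linarith) (by linarith) x' (w' + f x' p₂ q₂) x₂ v₂ hx'γ hv'γ
      (by rwa [add_sub_cancel_right]) (by linarith) (by linarith) hm₂
    have h2 := norm_sub_two_smul_le_of_inner (by positivity) h1
    have h3 : v₁ - v₂ - (2 * (κ / 2)) • (x₁ - x₂) =
        (v₁ - (w' + f x' p₂ q₂)) + ((w' + f x' p₂ q₂ - v₂) - (2 * (κ / 2)) • (x' - x₂)) -
          (2 * (κ / 2)) • (x₁ - x') := by
      simp only [smul_sub]; abel
    have h4 : ‖(2 * (κ / 2)) • (x₁ - x')‖ ≤ κ * (ℓ * dist p₁ p₂) := by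
      rw [norm_smul, Real.norm_of_nonneg (by positivity), mul_div_cancel₀ _ two_ne_zero]
      exact mul_le_mul_of_nonneg_left hx' hκ.le
    have h5 := norm_sub_le_norm_sub_add_norm_sub (w' + f x' p₂ q₂) v₁ v₂
    rw [norm_sub_rev _ v₁] at h5
    rw [h3]
    refine ((norm_sub_le _ _).trans (add_le_add_left (norm_add_le _ _) _)).trans ?_
    have h6 : 0 ≤ (2 * ℓ + κ * ℓ + 2 * (L * ℓ)) * dist q₁ q₂ := by positivity
    linarith

/-- The converse of `norm_sub_two_smul_le_of_inner`. -/
theorem inner_of_norm_sub_two_smul_le {v x : X} {κ : ℝ} (hκ : 0 < κ)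
    (h : ‖v - (2 * κ) • x‖ ≤ ‖v‖) : κ * ‖x‖ ^ 2 ≤ ⟪v, x⟫ := by
  have h1 := pow_le_pow_left₀ (norm_nonneg _) h 2
  rw [norm_sub_sq_real, real_inner_smul_right, norm_smul,
    Real.norm_of_nonneg (by positivity)] at h1
  refine le_of_mul_le_mul_left (a := 4 * κ) ?_ (by positivity)
  linarith

/-- A strongly monotone local selection `θ` of the inverse of `F + T` forces a lower estimate for
the regular coderivative of `T`. -/
theorem coderivative_lower_estimate [CompleteSpace X] {T : X → Set X} {F θ : X → X}
    {D : X →L[ℝ] X} {u v w z : X} {κ : ℝ} (hκ : 0 < κ) (hF : HasFDerivAt F D u)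
    (hmem : ∀ᶠ y in 𝓝 (v + F u), y - F (θ y) ∈ T (θ y))
    (hmono : ∀ᶠ y in 𝓝 (v + F u), ‖(y - (v + F u)) - (2 * κ) • (θ y - u)‖ ≤ ‖y - (v + F u)‖)
    (hz : z ∈ regCoderiv T u v w) : κ * ‖w‖ ^ 2 ≤ ⟪D w, w⟫ + ⟪z, w⟫ := by
  set y₀ := v + F u with hy₀
  have hlip : ∀ᶠ y in 𝓝 y₀, ‖θ y - u‖ ≤ 1 / κ * ‖y - y₀‖ := by
    filter_upwards [hmono] with y hy
    have h1 := norm_sub_le_norm_sub_add_norm_sub ((2 * κ) • (θ y - u)) (y - y₀) 0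
    rw [sub_zero, sub_zero, norm_sub_rev _ (y - y₀), norm_smul,
      Real.norm_of_nonneg (by positivity)] at h1
    rw [div_mul_eq_mul_div, le_div_iff₀ hκ]
    linarith
  have hcont : Tendsto θ (𝓝 y₀) (𝓝 u) := by
    rw [tendsto_iff_norm_sub_tendsto_zero]
    refine squeeze_zero' (Eventually.of_forall fun _ => norm_nonneg _) hlip ?_
    exact Continuous.tendsto' (by fun_prop) _ _ (by simp)
  have hdiff : ∀ e > (0:ℝ), ∀ᶠ y in 𝓝 y₀,
      ‖F (θ y) - F u - D (θ y - u)‖ ≤ e * ‖θ y - u‖ := fun e he =>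
    hcont.eventually (hF.isLittleO.def he)
  set z' := z + ContinuousLinearMap.adjoint D w with hz'
  have hz'in : ∀ x, ⟪z', x⟫ = ⟪z, x⟫ + ⟪w, D x⟫ := fun x => by
    rw [hz', inner_add_left, ContinuousLinearMap.adjoint_inner_left]
  have key : ∀ e > (0:ℝ), ∀ᶠ y in 𝓝 y₀, ⟪z', θ y - u⟫ ≤ ⟪w, y - y₀⟫ + e * ‖y - y₀‖ := by
    intro e he
    set C := 1 / κ + (1 + (‖D‖ + 1) * (1 / κ)) with hC
    have hC0 : 0 < C := by positivity
    have hpt : Tendsto (fun y => (θ y, y - F (θ y))) (𝓝 y₀) (𝓝 (u, v)) := by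
      have h1 : Tendsto (fun y => y - F (θ y)) (𝓝 y₀) (𝓝 (y₀ - F u)) :=
        tendsto_id.sub (hF.continuousAt.tendsto.comp hcont)
      rw [hy₀, add_sub_cancel_right] at h1
      exact hcont.prodMk_nhds h1
    have hn := hpt.eventually (eventually_nhdsWithin_iff.1 (hz (e / (2 * C)) (by positivity)))
    filter_upwards [hn, hmem, hlip, hdiff 1 one_pos, hdiff (e * κ / (2 * (‖w‖ + 1)))
      (by positivity)] with y hy hyT hyl hd1 hde
    have h1 := hy hyT
    have hsub : y - F (θ y) - v = (y - y₀) - (F (θ y) - F u) := by rw [hy₀]; abel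
    simp only [hsub] at h1
    set a := θ y - u
    set b := y - y₀
    set c := F (θ y) - F u
    have hc : ‖c‖ ≤ (‖D‖ + 1) * (1 / κ * ‖b‖) := by
      have h2 := norm_le_norm_sub_add c (D a)
      have h3 := D.le_opNorm a
      exact (show ‖c‖ ≤ (‖D‖ + 1) * ‖a‖ by linarith).trans
        (mul_le_mul_of_nonneg_left hyl (by positivity))
    have hsq : Real.sqrt (‖a‖ ^ 2 + ‖b - c‖ ^ 2) ≤ C * ‖b‖ := by
      have h2 : Real.sqrt (‖a‖ ^ 2 + ‖b - c‖ ^ 2) ≤ ‖a‖ + ‖b - c‖ :=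
        Real.sqrt_le_iff.2 ⟨by positivity, by
          nlinarith [mul_nonneg (norm_nonneg a) (norm_nonneg (b - c))]⟩
      have h3 := norm_sub_le b c
      rw [hC]
      linarith
    have h4 : e / (2 * C) * Real.sqrt (‖a‖ ^ 2 + ‖b - c‖ ^ 2) ≤ e / 2 * ‖b‖ := by
      refine (mul_le_mul_of_nonneg_left hsq (by positivity)).trans_eq ?_
      field_simp
    have h5 : ⟪w, D a⟫ - ⟪w, c⟫ ≤ e / 2 * ‖b‖ := by
      rw [← inner_sub_right]
      refine (real_inner_le_norm _ _).trans ?_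
      rw [norm_sub_rev]
      have h6 : ‖w‖ * ‖c - D a‖ ≤ (‖w‖ + 1) * (e * κ / (2 * (‖w‖ + 1)) * (1 / κ * ‖b‖)) :=
        mul_le_mul (by linarith) (hde.trans (mul_le_mul_of_nonneg_left hyl (by positivity)))
          (norm_nonneg _) (by positivity)
      refine h6.trans_eq ?_
      field_simp
    rw [inner_neg_left, inner_sub_right w b c] at h1
    rw [hz'in]
    linarith
  have hnorm : ‖z' - (2 * κ) • w‖ ≤ ‖z'‖ := by
    set b := z' - (2 * κ) • w with hb
    rcases eq_or_ne b 0 with h0 | h0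
    · rw [h0, norm_zero]; exact norm_nonneg _
    have hb0 : 0 < ‖b‖ := norm_pos_iff.2 h0
    refine le_of_forall_pos_le_add fun e he => ?_
    have ht : Tendsto (fun t : ℝ => y₀ + t • b) (𝓝[>] 0) (𝓝 y₀) :=
      (Continuous.tendsto' (by fun_prop) 0 y₀ (by simp)).mono_left nhdsWithin_le_nhds
    obtain ⟨t, ht0, h1, h2⟩ := (eventually_mem_nhdsWithin.and (ht.eventually
      ((key (e / (2 * κ)) (by positivity)).and hmono))).exists
    have ht0 : 0 < t := ht0
    rw [add_sub_cancel_left, norm_smul, Real.norm_of_nonneg ht0.le] at h1 h2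
    set a := θ (y₀ + t • b) - u
    have h3 := real_inner_le_norm z' (t • b - (2 * κ) • a)
    have h4 : ‖z'‖ * ‖t • b - (2 * κ) • a‖ ≤ ‖z'‖ * (t * ‖b‖) :=
      mul_le_mul_of_nonneg_left h2 (norm_nonneg _)
    rw [inner_sub_right, real_inner_smul_right, real_inner_smul_right] at h3
    rw [real_inner_smul_right] at h1
    have h5 : ‖b‖ ^ 2 = ⟪z', b⟫ - 2 * κ * ⟪w, b⟫ := by
      rw [← real_inner_self_eq_norm_sq, ← real_inner_smul_left, ← inner_sub_left]
    have h6 : 2 * κ * (t * ⟪w, b⟫ + e / (2 * κ) * (t * ‖b‖)) =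
        2 * κ * (t * ⟪w, b⟫) + e * (t * ‖b‖) := by
      field_simp
    have h7 := mul_le_mul_of_nonneg_left h1 (show 0 ≤ 2 * κ by positivity)
    refine le_of_mul_le_mul_right (a := t * ‖b‖) ?_ (by positivity)
    have h8 : t * ‖b‖ ^ 2 = t * (⟪z', b⟫ - 2 * κ * ⟪w, b⟫) := by rw [h5]
    linarith
  have h1 := inner_of_norm_sub_two_smul_le hκ hnorm
  rw [hz'in, real_inner_comm (D w) w] at h1
  linarith

/-- Full stability implies the neighborhood second-order condition. -/
theorem LipFullStable.soc [CompleteSpace X] {f : X → P → Q → X} {Df : X → P → Q → X →L[ℝ] X}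
    {g : X → P → EReal} {xb vb vh : X} {pb : P} {qb : Q} (hvh : vh = vb - f xb pb qb)
    (hA1 : A1 f xb pb qb) (hA4 : A4 f Df xb pb qb)
    (h : LipFullStable (SolMap f g) xb vb pb qb) :
    ∃ η > (0:ℝ), ∃ κ₀ > (0:ℝ), SOC g (Df xb pb qb) xb pb vh η κ₀ := by
  obtain ⟨V, hV, Pn, hP, Qn, hQ, U, hU, ϑ, hloc, κ, hκ, ℓ, hℓ, hstab⟩ := h
  obtain ⟨L, hL, ε, hε, hf⟩ := hA1
  obtain ⟨⟨δ, hδ, hunif⟩, hD⟩ := hA4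
  obtain ⟨α, hα, hVα⟩ := Metric.mem_nhds_iff.1 hV
  obtain ⟨β, hβ, hPβ⟩ := Metric.mem_nhds_iff.1 hP
  obtain ⟨γ, hγ, hUγ⟩ := Metric.mem_nhds_iff.1 hU
  obtain ⟨τ, hτ, hDτ⟩ := Metric.tendsto_nhds_nhds.1 hD (κ / 2) (by positivity)
  have h1 : Tendsto (fun η : ℝ => η + L * (η + η)) (𝓝[>] 0) (𝓝 0) :=
    (Continuous.tendsto' (by fun_prop) 0 0 (by simp)).mono_left nhdsWithin_le_nhds
  have h2 : Tendsto (fun η : ℝ => η) (𝓝[>] 0) (𝓝 0) := tendsto_id.mono_left nhdsWithin_le_nhds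
  obtain ⟨η, hη, hηα, hηm⟩ := (eventually_mem_nhdsWithin.and ((h1.eventually_lt_const hα).and
    (h2.eventually_lt_const (show 0 < min ε (min δ (min β (min γ τ))) by positivity)))).exists
  simp only [lt_min_iff] at hηm
  obtain ⟨hηε, hηδ, hηβ, hηγ, hητ⟩ := hηm
  refine ⟨η, hη, κ / 2, by positivity, fun u p v hu hp hv hmem w z hz => ?_⟩
  have hy₀ : v + f u p qb ∈ ball vb α := by
    have h3 : v + f u p qb - vb = (v - vh) + (f u p qb - f xb pb qb) := by rw [hvh]; abel
    have h4 := hf u xb p pb qb qb (by linarith) (by simpa) (by linarith) (by simpa) (by simpa)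
      (by simpa)
    rw [dist_self, add_zero] at h4
    have h5 : L * (‖u - xb‖ + dist p pb) ≤ L * (η + η) :=
      mul_le_mul_of_nonneg_left (by linarith) hL.le
    rw [mem_ball_iff_norm, h3]
    refine (norm_add_le _ _).trans_lt ?_
    linarith
  have hpP : p ∈ Pn := hPβ (hp.trans_lt hηβ)
  have hqQ : qb ∈ Qn := mem_of_mem_nhds hQ
  have huU : u ∈ U := hUγ (mem_ball_iff_norm.2 (hu.trans_lt hηγ))
  have hfix : ϑ (v + f u p qb) p qb = u := by
    refine ((hloc _ (hVα hy₀) p hpP qb hqQ).2.2 u huU ?_).symm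
    show v + f u p qb - f u p qb ∈ pSubdiff g u p
    rwa [add_sub_cancel_right]
  have hevV : ∀ᶠ y in 𝓝 (v + f u p qb), y ∈ V :=
    mem_of_superset (isOpen_ball.mem_nhds hy₀) hVα
  have hder : HasFDerivAt (fun x => f x p qb) (Df u p qb) u := by
    refine .of_isLittleO (Asymptotics.IsLittleO.of_bound fun e he => ?_)
    obtain ⟨d, hd, hfd⟩ := hunif e he
    filter_upwards [ball_mem_nhds u hd] with x hx
    exact hfd u p qb (by linarith) (by linarith) (by simpa) x (mem_ball_iff_norm.1 hx)
  have h3 := coderivative_lower_estimate (F := fun x => f x p qb) (θ := fun y => ϑ y p qb) hκ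
    hder (hevV.mono fun y hy => (hloc y hy p hpP qb hqQ).2.1)
    (hevV.mono fun y hy => by
      have h4 := hstab y hy p hpP qb hqQ (v + f u p qb) (hVα hy₀) p hpP qb hqQ
      simpa [hfix] using h4) hz
  have h4 : ‖Df u p qb - Df xb pb qb‖ < κ / 2 := by
    rw [← dist_eq_norm]
    refine hDτ (x := (u, p, qb)) ?_
    simp only [Prod.dist_eq, sup_lt_iff, dist_eq_norm]
    exact ⟨hu.trans_lt hητ, hp.trans_lt hητ, by simpa⟩
  have h5 : ⟪Df u p qb w, w⟫ - ⟪Df xb pb qb w, w⟫ ≤ κ / 2 * ‖w‖ ^ 2 := by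
    rw [← inner_sub_left, ← sub_apply]
    refine (real_inner_le_norm _ _).trans ?_
    have h6 := (Df u p qb - Df xb pb qb).le_opNorm w
    nlinarith [norm_nonneg w]
  linarith

/-- Full stability implies the Lipschitz-like property of the graphical map. -/
theorem LipFullStable.lipschitzLike {f : X → P → Q → X} {g : X → P → EReal} {xb vb vh : X}
    {pb : P} {qb : Q} (hvh : vh = vb - f xb pb qb) (hA1 : A1 f xb pb qb)
    (h : LipFullStable (SolMap f g) xb vb pb qb) :
    LipschitzLike (fun p => gphMap g p) pb (xb, vh) := by
  obtain ⟨V, hV, Pn, hP, Qn, hQ, U, hU, ϑ, hloc, κ, hκ, ℓ, hℓ, hstab⟩ := h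
  obtain ⟨L, hL, ε, hε, hf⟩ := hA1
  obtain ⟨α, hα, hVα⟩ := Metric.mem_nhds_iff.1 hV
  obtain ⟨β, hβ, hPβ⟩ := Metric.mem_nhds_iff.1 hP
  obtain ⟨γ, hγ, hUγ⟩ := Metric.mem_nhds_iff.1 hU
  set m := ℓ / (2 * κ) with hm
  have hm0 : 0 < m := by positivity
  have h1 : Tendsto (fun η : ℝ => η + L * (η + η)) (𝓝[>] 0) (𝓝 0) :=
    (Continuous.tendsto' (by fun_prop) 0 0 (by simp)).mono_left nhdsWithin_le_nhds
  have h2 : Tendsto (fun η : ℝ => η + m * (η + η)) (𝓝[>] 0) (𝓝 0) :=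
    (Continuous.tendsto' (by fun_prop) 0 0 (by simp)).mono_left nhdsWithin_le_nhds
  obtain ⟨η, hη, hηα, hηm⟩ := (eventually_mem_nhdsWithin.and ((h1.eventually_lt_const hα).and
    (h2.eventually_lt_const (show 0 < min ε (min β γ) by positivity)))).exists
  have hη : 0 < η := hη
  have hmη : 0 < m * η := by positivity
  simp only [lt_min_iff] at hηm
  obtain ⟨hηε, hηβ, hηγ⟩ := hηm
  refine ⟨m + L * (m + 1), by positivity, ball pb η, ball_mem_nhds _ hη, ball (xb, vh) η,
    ball_mem_nhds _ hη, ?_⟩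
  rintro p hp p' hp' ⟨u, v⟩ ⟨hmem, hball⟩
  rw [mem_ball] at hp hp'
  rw [mem_ball, Prod.dist_eq, sup_lt_iff, dist_eq_norm, dist_eq_norm] at hball
  obtain ⟨hu, hv⟩ : ‖u - xb‖ < η ∧ ‖v - vh‖ < η := hball
  have hqQ : qb ∈ Qn := mem_of_mem_nhds hQ
  have hpP : p ∈ Pn := hPβ (mem_ball.2 (by linarith))
  have hpP' : p' ∈ Pn := hPβ (mem_ball.2 (by linarith))
  have huU : u ∈ U := hUγ (mem_ball_iff_norm.2 (by linarith))
  have hyV : v + f u p qb ∈ V := by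
    refine hVα ?_
    have h3 : v + f u p qb - vb = (v - vh) + (f u p qb - f xb pb qb) := by rw [hvh]; abel
    have h4 := hf u xb p pb qb qb (by linarith) (by simpa) (by linarith) (by simpa) (by simpa)
      (by simpa)
    rw [dist_self, add_zero] at h4
    have h5 : L * (‖u - xb‖ + dist p pb) ≤ L * (η + η) :=
      mul_le_mul_of_nonneg_left (by linarith) hL.le
    rw [mem_ball_iff_norm, h3]
    refine (norm_add_le _ _).trans_lt ?_
    linarith
  have hfix : ϑ (v + f u p qb) p qb = u := by
    refine ((hloc _ hyV p hpP qb hqQ).2.2 u huU ?_).symm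
    show v + f u p qb - f u p qb ∈ pSubdiff g u p
    rwa [add_sub_cancel_right]
  have hmem' : v + f u p qb - f (ϑ (v + f u p qb) p' qb) p' qb ∈
      pSubdiff g (ϑ (v + f u p qb) p' qb) p' := (hloc _ hyV p' hpP' qb hqQ).2.1
  have h3 := hstab _ hyV p hpP qb hqQ _ hyV p' hpP' qb hqQ
  rw [hfix] at h3
  set u' := ϑ (v + f u p qb) p' qb
  rw [sub_self, zero_sub, norm_neg, norm_zero, zero_add, dist_self, add_zero, norm_smul,
    Real.norm_of_nonneg (by positivity)] at h3
  have huu : ‖u - u'‖ ≤ m * dist p p' := by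
    rw [hm, div_mul_eq_mul_div, le_div_iff₀ (by positivity)]
    linarith
  have hpp : m * dist p p' ≤ m * (η + η) :=
    mul_le_mul_of_nonneg_left (by linarith [dist_triangle_right p p' pb]) hm0.le
  have hu' : ‖u' - xb‖ < ε := by
    have h4 := norm_sub_le_norm_sub_add_norm_sub u' u xb
    rw [norm_sub_rev u' u] at h4
    linarith
  have h4 := hf u u' p p' qb qb (by linarith) hu' (by linarith) (by linarith) (by simpa)
    (by simpa)
  rw [dist_self, add_zero] at h4
  have h5 : L * (‖u - u'‖ + dist p p') ≤ L * (m * dist p p' + dist p p') :=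
    mul_le_mul_of_nonneg_left (by linarith) hL.le
  have h6 : 0 ≤ L * (m + 1) * dist p p' := by positivity
  have h7 : 0 ≤ m * dist p p' := by positivity
  refine ⟨(u', v + f u p qb - f u' p' qb), hmem', ?_⟩
  have h8 : v - (v + f u p qb - f u' p' qb) = -(f u p qb - f u' p' qb) := by abel
  rw [Prod.mk_sub_mk, h8, Prod.norm_mk, norm_neg]
  exact max_le (by linarith) (by linarith)

theorem StrongResolvent.mono {T : X → Set X} {A : X →L[ℝ] X} {xb vh : X} {s σ κ ρ δ δ' : ℝ}
    {J : X → X} (hJ : StrongResolvent T A xb vh s σ κ ρ δ J) (h : δ' ≤ δ) :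
    StrongResolvent T A xb vh s σ κ ρ δ' J :=
  { hJ with eq := fun u v hu hv => hJ.eq u v (hu.trans_le h) (hv.trans_le h) }

/-- The neighborhood second-order condition together with the Lipschitz-like property of the
graphical map implies full stability. -/
theorem lipFullStable_of_soc_of_lipschitzLike [CompleteSpace X] {f : X → P → Q → X}
    {Df : X → P → Q → X →L[ℝ] X} {g : X → P → EReal} {xb vb vh : X} {pb : P} {qb : Q} {r η κ : ℝ}
    (hlsc : ∀ p, LowerSemicontinuous fun x => g x p) (hbot : ∀ x p, g x p ≠ ⊥)
    (hvh : vh = vb - f xb pb qb) (hsol : xb ∈ SolMap f g vb pb qb)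
    (hA1 : A1 f xb pb qb) (hA4 : A4 f Df xb pb qb) (hr : 0 < r)
    (hprox : ProxRegWith g xb pb vh r) (hη : 0 < η) (hκ : 0 < κ)
    (hsoc : SOC g (Df xb pb qb) xb pb vh η κ)
    (hlip : LipschitzLike (fun p => gphMap g p) pb (xb, vh)) :
    LipFullStable (SolMap f g) xb vb pb qb := by
  obtain ⟨ε, hε, hprox⟩ := hprox
  obtain ⟨L, hL, ε₁, hε₁, hf⟩ := hA1
  obtain ⟨δ₁, hδ₁, hfA⟩ := hA4.strict (show 0 < κ / 4 by positivity)
  obtain ⟨ℓ, hℓ, U, hU, V, hV, hlip⟩ := hlip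
  obtain ⟨α, hα, hUα⟩ := Metric.mem_nhds_iff.1 hU
  obtain ⟨β, hβ, hVβ⟩ := Metric.mem_nhds_iff.1 hV
  set A := Df xb pb qb
  have hmem : vh ∈ pSubdiff g xb pb := hvh ▸ hsol
  obtain ⟨s, hrs, hAs, hAsq⟩ : ∃ s, r < s ∧ ‖A‖ ≤ s + κ ∧ ‖A‖ ^ 2 ≤ s * κ := by
    have h0 : 0 ≤ ‖A‖ ^ 2 / κ := by positivity
    refine ⟨r + ‖A‖ + ‖A‖ ^ 2 / κ + 1, ?_, ?_, ?_⟩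
    · linarith [norm_nonneg A]
    · linarith
    · have h1 : ‖A‖ ^ 2 = ‖A‖ ^ 2 / κ * κ := by field_simp
      have h2 : 0 ≤ (r + ‖A‖ + 1) * κ := by positivity
      linarith
  have hs : 0 < s := hr.trans hrs
  have hσ : 0 < s - r := sub_pos.2 hrs
  obtain ⟨d, hd, hdε, hdη, hdε₁, hdδ₁, hdα, hdβ⟩ :
      ∃ d > 0, d ≤ ε ∧ d < η ∧ d ≤ ε₁ ∧ d ≤ δ₁ ∧ d ≤ α ∧ d ≤ β := by
    refine ⟨min ε (min (η / 2) (min ε₁ (min δ₁ (min α β)))), by positivity, ?_⟩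
    have hη2 : η / 2 < η := half_lt_self hη
    simp only [min_le_iff, min_lt_iff, le_refl, hη2, true_or, or_true, and_self]
  obtain ⟨R, hR, hRd, hsR⟩ : ∃ R > 0, 2 * R < d ∧ 3 * s * R < d := by
    refine ⟨d / (3 * (s + 1)), by positivity, ?_, ?_⟩
    · rw [mul_div_assoc', div_lt_iff₀ (by positivity)]
      nlinarith
    · rw [mul_div_assoc', div_lt_iff₀ (by positivity)]
      nlinarith
  set ρ := (s - r) * R / 16 with hρdef
  have hρ : 0 < ρ := by positivity
  obtain ⟨δ, hδ, hδd, hδρ⟩ : ∃ δ > 0, δ ≤ d ∧ (1 + s) * (ℓ * δ) ≤ ρ := by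
    refine ⟨min d (ρ / ((1 + s) * ℓ)), by positivity, min_le_left _ _, ?_⟩
    have h1 := mul_le_mul_of_nonneg_left (min_le_right d (ρ / ((1 + s) * ℓ)))
      (show 0 ≤ (1 + s) * ℓ by positivity)
    rw [mul_div_cancel₀ _ (by positivity)] at h1
    linarith
  have hT : ∀ p p', dist p pb < δ → dist p' pb < δ → ∀ x w, ‖x - xb‖ < δ → ‖w - vh‖ < δ →
      w ∈ pSubdiff g x p → ∃ x' w', w' ∈ pSubdiff g x' p' ∧
        ‖x - x'‖ ≤ ℓ * dist p p' ∧ ‖w - w'‖ ≤ ℓ * dist p p' := by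
    intro p p' hp hp' x w hx hw hxw
    have hβ' : (x, w) ∈ ball (xb, vh) β := by
      rw [mem_ball_iff_norm, Prod.mk_sub_mk, Prod.norm_mk]
      exact max_lt (by linarith) (by linarith)
    obtain ⟨⟨x', w'⟩, hz', hd'⟩ := hlip p (hUα (mem_ball.2 (by linarith))) p'
      (hUα (mem_ball.2 (by linarith))) (x, w) ⟨hxw, hVβ hβ'⟩
    rw [Prod.mk_sub_mk] at hd'
    exact ⟨x', w', hz', (norm_fst_le (x - x', w - w')).trans hd',
      (norm_snd_le (x - x', w - w')).trans hd'⟩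
  have hJ : ∀ p, ∃ J, dist p pb < δ →
      StrongResolvent (fun x => pSubdiff g x p) A xb vh s (s - r) κ ρ δ J := by
    intro p
    by_cases hp : dist p pb < δ
    · obtain ⟨x₀, v₀, h₀, hx₀, hv₀⟩ := hT pb p (by simpa) hp xb vh (by simpa) (by simpa) hmem
      rw [norm_sub_rev, dist_comm] at hx₀ hv₀
      obtain ⟨J, hJ⟩ := exists_strongResolvent (h := fun x => g x p) (xb := xb) (vh := vh)
        (hlsc p) (fun x => hbot x p) hr hrs hR hAs hRd hsR
        (fun x u v hx hu hv hvu => hprox x u p v (by linarith) (by linarith) (by linarith)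
          (by linarith) hvu)
        (fun u v hu hv hvu => hsoc u p v (by linarith) (by linarith) (by linarith) hvu) h₀ (by
          have h1 := mul_le_mul_of_nonneg_left hx₀ hs.le
          have h2 : (1 + s) * (ℓ * dist p pb) ≤ (1 + s) * (ℓ * δ) := by gcongr
          linarith)
      exact ⟨J, fun _ => hJ.mono hδd⟩
    · exact ⟨fun _ => 0, fun h => absurd h hp⟩
  choose J hJ using hJ
  exact lipFullStable_of_strongResolvent hvh hs hσ hκ hAsq hρ hδ hL hℓ hmem hJ hT
    (fun x₁ x₂ p₁ p₂ q₁ q₂ h₁ h₂ h₃ h₄ h₅ h₆ => hf x₁ x₂ p₁ p₂ q₁ q₂ (by linarith) (by linarith)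
      (by linarith) (by linarith) (by linarith) (by linarith))
    (fun x₁ x₂ p q h₁ h₂ h₃ h₄ => hfA x₁ x₂ p q (by linarith) (by linarith) (by linarith)
      (by linarith))
/-- neighborhood second-order characterization of Lipschitzian full
stability of general parametric variational systems (Proposition 4.1). -/
theorem statement0
    {X : Type*} [NormedAddCommGroup X] [InnerProductSpace ℝ X] [CompleteSpace X]
    {P : Type*} [MetricSpace P] {Q : Type*} [MetricSpace Q]
    (f : X → P → Q → X) (Df : X → P → Q → X →L[ℝ] X) (g : X → P → EReal)
    (xb vb vh : X) (pb : P) (qb : Q)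
    (hg_lsc : LowerSemicontinuous fun t : X × P => g t.1 t.2)
    (hg_proper : ∀ x p, g x p ≠ ⊥)
    (hvh : vh = vb - f xb pb qb)
    (hsol : xb ∈ SolMap f g vb pb qb)
    (hA1 : A1 f xb pb qb) (hA2 : A2 g xb pb vh) (hA3 : A3 g xb pb)
    (hA4 : A4 f Df xb pb qb) :
    ((∃ η > (0:ℝ), ∃ κ₀ > (0:ℝ), SOC g (Df xb pb qb) xb pb vh η κ₀) ∧
        LipschitzLike (fun p => gphMap g p) pb (xb, vh)) ↔
      LipFullStable (SolMap f g) xb vb pb qb := by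
  obtain ⟨⟨r, hr, hprox⟩, -⟩ := hA2
  have hlsc : ∀ p, LowerSemicontinuous fun x => g x p := fun p =>
    hg_lsc.comp (Continuous.prodMk_left p)
  constructor
  · rintro ⟨⟨η, hη, κ, hκ, hsoc⟩, hlip⟩
    exact lipFullStable_of_soc_of_lipschitzLike hlsc hg_proper hvh hsol hA1 hA4 hr hprox hη hκ
      hsoc hlip
  · exact fun h => ⟨h.soc hvh hA1 hA4, h.lipschitzLike hvh hA1⟩

end PVS
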